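/- arXiv:2107.01876 — 9 statements merged into one kernel-verified Lean document; each statement's English description precedes it below -/
import Mathlib

section
/- There exist real parameters a_y ∈ (0,1), a_{m|y} ∈ [0,1] for y ∈ {0,1}, and a_{s|m,y} ∈ (0,1) for m, y ∈ {0,1} with the following property. Define the joint probability mass function on (y, m, s) ∈ {0,1}³ by q(y,m,s) = p_Y(y)·p_{M|Y}(m|y)·p_{S|MY}(s|m,y), where p_Y(1) = a_y, p_{M|Y}(1|y) = a_{m|y}, and p_{S|MY}(1|m,y) = a_{s|m,y} (the complementary values having the complementary probabilities). Define f_S(s,m) := p_Y(1)·p_{S|MY}(s|m,1) / (p_Y(1)·p_{S|MY}(s|m,1) + p_Y(0)·p_{S|MY}(s|m,0)) and f_∅ := a_y. Then Σ_{y,m,s ∈ {0,1}} q(y,m,s)·(y − f_S(s,m))² > Σ_{y,m,s ∈ {0,1}} q(y,m,s)·(y − f_∅)². -/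
/-- There exist parameters `a_y ∈ (0,1)`, `a_{m|y} ∈ [0,1]`,
`a_{s|m,y} ∈ (0,1)` such that, with the joint pmf
`q(y,m,s) = p_Y(y) p_{M|Y}(m|y) p_{S|MY}(s|m,y)` on `{0,1}³`, the predictor
`f_S(s,m) = p_Y(1) p_{S|MY}(s|m,1) / (p_Y(1) p_{S|MY}(s|m,1) + p_Y(0) p_{S|MY}(s|m,0))`
has strictly larger quadratic risk than the constant predictor `f_∅ = a_y`:
`Σ q(y,m,s) (y - f_S(s,m))² > Σ q(y,m,s) (y - f_∅)²`. -/
theorem whole_stable_set_not_minimax :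
    ∃ (ay : ℝ) (am : Fin 2 → ℝ) (aS : Fin 2 → Fin 2 → ℝ),
      0 < ay ∧ ay < 1 ∧
      (∀ y : Fin 2, 0 ≤ am y ∧ am y ≤ 1) ∧
      (∀ m y : Fin 2, 0 < aS m y ∧ aS m y < 1) ∧
      (let pY : Fin 2 → ℝ := fun y => if y = 1 then ay else 1 - ay
       let pM : Fin 2 → Fin 2 → ℝ := fun m y => if m = 1 then am y else 1 - am y
       let pS : Fin 2 → Fin 2 → Fin 2 → ℝ := fun s m y => if s = 1 then aS m y else 1 - aS m y
       let q : Fin 2 → Fin 2 → Fin 2 → ℝ := fun y m s => pY y * pM m y * pS s m y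
       let fS : Fin 2 → Fin 2 → ℝ := fun s m =>
         pY 1 * pS s m 1 / (pY 1 * pS s m 1 + pY 0 * pS s m 0)
       ∑ y : Fin 2, ∑ m : Fin 2, ∑ s : Fin 2, q y m s * (((y : ℕ) : ℝ) - ay) ^ 2
         < ∑ y : Fin 2, ∑ m : Fin 2, ∑ s : Fin 2, q y m s * (((y : ℕ) : ℝ) - fS s m) ^ 2) := by
  refine ⟨9/10, ![0, 1], ![![1/2, 1/2], ![1/2, 3/5]], by norm_num, by norm_num, ?_, ?_, ?_⟩
  · intro y
    fin_cases y <;> norm_num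
  · intro m y
    fin_cases m <;> fin_cases y <;> norm_num
  · simp [Fin.sum_univ_two]
    norm_num
end

section
/- Let G be a finite DAG over variables V = {Y} ∪ X, each taking values in a finite set, and let strictly positive conditional probability tables p(v_i | pa(v_i)) be given for every V_i ∈ V, defining the positive joint distribution p(v) = ∏_i p(v_i | pa(v_i)). Fix a subset X_M⁰ ⊆ Ch(Y) of children of Y, and let W := De(X_M⁰) ∖ X_M⁰ and W₂ := X ∖ (X_M⁰ ∪ De(X_M⁰)). Suppose Y has no edge into any vertex of W. Then for every full assignment (y, w, w₂, x_M⁰), the truncated-factorization conditional p(y | w, w₂, do(x_M⁰)) := [p(y|pa(y)) ∏_{X_j ∈ W} p(x_j|pa(x_j)) ∏_{X_i ∈ W₂} p(x_i|pa(x_i))] / [Σ_{y'} p(y'|pa(y')) ∏_{X_j ∈ W} p(x_j|pa(x_j)) ∏_{X_i ∈ W₂} p(x_i|pa(x_i))], where all parent values are read off the given assignment (with y replaced by y' in the denominator), equals the observational conditional p(y | w₂) computed from the joint p. -/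
/-- A finite directed acyclic graph on a vertex type `V`: an edge relation with no
directed cycles. -/
structure FinDAG (V : Type*) where
  edge : V → V → Prop
  acyclic : ∀ v, ¬ Relation.TransGen edge v v

open Classical in
theorem sum_fiber_split {V : Type*} [Fintype V] [DecidableEq V] {α : Type*} [Fintype α]
    (f : (V → α) → ℝ) (m : V) (A B : Set V) (hm : m ∉ A)
    (hB : ∀ v, v ∈ B ↔ v = m ∨ v ∈ A) (σ : V → α) :
    ∑ τ : V → α, Set.indicator {τ' : V → α | ∀ w ∈ A, τ' w = σ w} f τ =
      ∑ a : α, ∑ τ : V → α,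
        Set.indicator {τ' : V → α | ∀ w ∈ B, τ' w = Function.update σ m a w} f τ := by
  rw [Finset.sum_comm]
  refine Finset.sum_congr rfl fun τ _ => ?_
  have key : ∀ a, (∀ w ∈ B, τ w = Function.update σ m a w) ↔
      (a = τ m ∧ ∀ w ∈ A, τ w = σ w) := by
    intro a
    constructor
    · intro h
      refine ⟨by simpa using (h m ((hB m).2 (Or.inl rfl))).symm, fun w hw => ?_⟩
      have := h w ((hB w).2 (Or.inr hw))
      rwa [Function.update_of_ne (fun e => hm (by rw [← e]; exact hw))] at this
    · rintro ⟨rfl, h⟩ w hw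
      by_cases e : w = m
      · subst e; simp
      · rw [Function.update_of_ne e]
        exact h w (((hB w).1 hw).resolve_left e)
  simp only [Set.indicator_apply, Set.mem_ofPred_eq, key, ite_and]
  simp

open Classical in
theorem sum_out_upper {V : Type*} [Fintype V] [DecidableEq V] {α : Type*} [Fintype α]
    (G : FinDAG V)
    (cpt : V → (V → α) → ℝ)
    (hlocal : ∀ v (σ σ' : V → α), σ v = σ' v → (∀ w, G.edge w v → σ w = σ' w) →
      cpt v σ = cpt v σ')
    (hnorm : ∀ v (σ : V → α), ∑ a : α, cpt v (Function.update σ v a) = 1) (n : ℕ) :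
    ∀ (S : Finset V), S.card = n → (∀ v ∈ S, ∀ w, G.edge v w → w ∈ S) → ∀ σ : V → α,
    ∑ τ : V → α, Set.indicator {τ' : V → α | ∀ w ∈ {v | v ∉ S}, τ' w = σ w}
      (fun τ => ∏ v : V, cpt v τ) τ = ∏ v ∈ Sᶜ, cpt v σ := by
  induction n with
  | zero =>
    intro S hS _ σ
    rw [Finset.card_eq_zero] at hS
    subst hS
    have : ∀ τ : V → α, (∀ w, τ w = σ w) ↔ τ = σ := fun τ => funext_iff.symm
    simp [Set.indicator_apply, this]
  | succ n ih =>
    intro S hS hup σ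
    have hne : (S : Set V).Nonempty := by
      rw [Finset.coe_nonempty, ← Finset.card_pos]; omega
    have : IsTrans V (Relation.TransGen G.edge) := ⟨fun _ _ _ => Relation.TransGen.trans⟩
    have : Std.Irrefl (Relation.TransGen G.edge) := ⟨G.acyclic⟩
    have wf := Finite.wellFounded_of_trans_of_irrefl (Relation.TransGen G.edge)
    obtain ⟨m, hmS, hmin⟩ := wf.has_min (S : Set V) hne
    rw [Finset.mem_coe] at hmS
    rw [sum_fiber_split _ m {v | v ∉ S} {v | v ∉ S.erase m} (by simpa using hmS)
      (by intro v; simp only [Set.mem_ofPred_eq, Finset.mem_erase]; tauto)]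
    have hc : (S.erase m)ᶜ = insert m Sᶜ := by
      ext v; simp only [Finset.mem_compl, Finset.mem_erase, Finset.mem_insert]; tauto
    have step : ∀ a : α, ∑ τ : V → α, Set.indicator
        {τ' : V → α | ∀ w ∈ {v | v ∉ S.erase m}, τ' w = Function.update σ m a w}
        (fun τ => ∏ v : V, cpt v τ) τ =
        cpt m (Function.update σ m a) * ∏ v ∈ Sᶜ, cpt v σ := by
      intro a
      rw [ih (S.erase m) (by rw [Finset.card_erase_of_mem hmS]; omega), hc,
        Finset.prod_insert (by simpa using hmS)]
      · congr 1
        refine Finset.prod_congr rfl fun v hv => ?_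
        rw [Finset.mem_compl] at hv
        refine hlocal _ _ _ ?_ fun w hw => ?_
        · exact Function.update_of_ne (fun e => hv (by rw [e]; exact hmS)) _ _
        · exact Function.update_of_ne (fun e => hv (hup m hmS v (by rw [← e]; exact hw))) _ _
      · intro v hv w hw
        rw [Finset.mem_erase] at hv ⊢
        refine ⟨?_, hup v hv.2 w hw⟩
        rintro rfl
        exact hmin v hv.2 (Relation.TransGen.single hw)
    rw [Finset.sum_congr rfl fun a _ => step a, ← Finset.sum_mul, hnorm, one_mul]

/-- Let `G` be a finite DAG over `{Y} ∪ X` with finitely-valued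
variables and strictly positive conditional probability tables `cpt v` (each depending
only on the value of `v` and of its parents, and normalized). Fix `X_M⁰ ⊆ Ch(Y)`, let
`W := De(X_M⁰) ∖ X_M⁰` and `W₂ := X ∖ (X_M⁰ ∪ De(X_M⁰))`, and suppose `Y` has no edge
into any vertex of `W`. Then for every full assignment `σ`, the truncated-factorization
conditional `p(y | w, w₂, do(x_M⁰))` equals the observational conditional `p(y | w₂)`
computed from the joint `p(v) = ∏ᵢ p(vᵢ | pa(vᵢ))`. -/
theorem truncated_factorization_degenerates
    {V : Type*} [Fintype V] [DecidableEq V] {α : Type*} [Fintype α]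
    (G : FinDAG V) (y0 : V)
    (cpt : V → (V → α) → ℝ)
    (hpos : ∀ v σ, 0 < cpt v σ)
    (hlocal : ∀ v (σ σ' : V → α), σ v = σ' v → (∀ w, G.edge w v → σ w = σ' w) →
      cpt v σ = cpt v σ')
    (hnorm : ∀ v (σ : V → α), ∑ a : α, cpt v (Function.update σ v a) = 1)
    (XM0 : Set V) (hch : ∀ v ∈ XM0, G.edge y0 v) :
    let De : Set V → Set V := fun A => {v | ∃ a ∈ A, Relation.TransGen G.edge a v}
    let W : Set V := De XM0 \ XM0
    let W2 : Set V := {v | v ≠ y0} \ (XM0 ∪ De XM0)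
    let P : (V → α) → ℝ := fun τ => ∏ v : V, cpt v τ
    let num : (V → α) → ℝ := fun τ =>
      cpt y0 τ * (∏ v : V, W.mulIndicator (fun u => cpt u τ) v) *
        (∏ v : V, W2.mulIndicator (fun u => cpt u τ) v)
    (∀ w ∈ W, ¬ G.edge y0 w) →
    ∀ σ : V → α,
      num σ / (∑ y' : α, num (Function.update σ y0 y')) =
        (∑ τ : V → α,
            Set.indicator {τ' : V → α | τ' y0 = σ y0 ∧ ∀ w ∈ W2, τ' w = σ w} P τ) /
          (∑ τ : V → α, Set.indicator {τ' : V → α | ∀ w ∈ W2, τ' w = σ w} P τ) := by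
  classical
  intro De W W2 P num hW σ
  set S : Finset V := Finset.univ.filter (fun v => v ∈ XM0 ∪ De XM0) with hSdef
  have hS : ∀ v, v ∈ S ↔ v ∈ XM0 ∪ De XM0 := fun v => by simp [hSdef]
  have hup : ∀ v ∈ S, ∀ w, G.edge v w → w ∈ S := by
    intro v hv w hw
    rw [hS] at hv ⊢
    right
    rcases hv with hv | ⟨a, ha, hav⟩
    · exact ⟨v, hv, Relation.TransGen.single hw⟩
    · exact ⟨a, ha, hav.tail hw⟩
  have hy : y0 ∉ S := by
    rw [hS]
    rintro (h | ⟨a, ha, h⟩)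
    · exact G.acyclic y0 (Relation.TransGen.single (hch _ h))
    · exact G.acyclic y0 (Relation.TransGen.head (hch _ ha) h)
  have hmW2 : ∀ v, v ∈ W2 ↔ v ≠ y0 ∧ v ∉ S := fun v => by rw [hS]; rfl
  have hyW2 : y0 ∉ W2 := fun h => ((hmW2 y0).1 h).1 rfl
  have hcov : ∀ v, v ∈ {v | v ∉ S} ↔ v = y0 ∨ v ∈ W2 := by
    intro v
    rw [hmW2, Set.mem_ofPred_eq]
    by_cases e : v = y0
    · subst e; simp [hy]
    · simp [e]
  have marg := sum_out_upper G cpt hlocal hnorm S.card S rfl hup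
  have hden : ∑ τ : V → α, Set.indicator {τ' : V → α | ∀ w ∈ W2, τ' w = σ w} P τ =
      ∑ a : α, ∏ v ∈ Sᶜ, cpt v (Function.update σ y0 a) := by
    rw [sum_fiber_split P y0 W2 {v | v ∉ S} hyW2 hcov]
    exact Finset.sum_congr rfl fun a _ => marg _
  have hnum : ∑ τ : V → α,
      Set.indicator {τ' : V → α | τ' y0 = σ y0 ∧ ∀ w ∈ W2, τ' w = σ w} P τ =
      ∏ v ∈ Sᶜ, cpt v σ := by
    rw [← marg σ]
    have : {τ' : V → α | τ' y0 = σ y0 ∧ ∀ w ∈ W2, τ' w = σ w} =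
        {τ' : V → α | ∀ w ∈ {v | v ∉ S}, τ' w = σ w} := by
      ext τ
      constructor
      · rintro ⟨h1, h2⟩ w hw
        rcases (hcov w).1 hw with rfl | h
        · exact h1
        · exact h2 w h
      · intro h
        exact ⟨h y0 hy, fun w hw => h w ((hcov w).2 (Or.inr hw))⟩
    rw [this]
  have hN : ∀ τ, num τ = (∏ v : V, W.mulIndicator (fun u => cpt u τ) v) *
      ∏ v ∈ Sᶜ, cpt v τ := by
    intro τ
    have hc : Sᶜ = insert y0 (Finset.univ.filter (fun v => v ∈ W2)) := by
      ext v
      simpa using hcov v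
    have h2 : ∏ v : V, W2.mulIndicator (fun u => cpt u τ) v =
        ∏ v ∈ Finset.univ.filter (fun v => v ∈ W2), cpt v τ := by
      rw [Finset.prod_filter]
      exact Finset.prod_congr rfl fun v _ => Set.mulIndicator_apply _ _ _
    rw [hc, Finset.prod_insert (by simpa using hyW2), ← h2]
    simp only [num]
    ring
  have hWc : ∀ a, ∏ v : V, W.mulIndicator (fun u => cpt u (Function.update σ y0 a)) v =
      ∏ v : V, W.mulIndicator (fun u => cpt u σ) v := by
    intro a
    refine Finset.prod_congr rfl fun v _ => ?_
    by_cases hv : v ∈ W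
    · rw [Set.mulIndicator_of_mem hv, Set.mulIndicator_of_mem hv]
      refine hlocal _ _ _ ?_ fun w hw => ?_
      · exact Function.update_of_ne
          (fun e => hy (by rw [← e, hS]; exact Or.inr hv.1)) _ _
      · exact Function.update_of_ne (fun e => hW v hv (by rw [← e]; exact hw)) _ _
    · rw [Set.mulIndicator_of_notMem hv, Set.mulIndicator_of_notMem hv]
  have hWpos : 0 < ∏ v : V, W.mulIndicator (fun u => cpt u σ) v := by
    refine Finset.prod_pos fun v _ => ?_
    by_cases hv : v ∈ W
    · rw [Set.mulIndicator_of_mem hv]; exact hpos _ _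
    · rw [Set.mulIndicator_of_notMem hv]; exact one_pos
  rw [hden, hnum, hN σ]
  have : ∑ y' : α, num (Function.update σ y0 y') =
      (∏ v : V, W.mulIndicator (fun u => cpt u σ) v) *
        ∑ a : α, ∏ v ∈ Sᶜ, cpt v (Function.update σ y0 a) := by
    rw [Finset.mul_sum]
    exact Finset.sum_congr rfl fun a _ => by rw [hN, hWc]
  rw [this, mul_div_mul_left _ _ hWpos.ne']
end

section
/- Let G be a finite DAG over a target vertex Y and a set of covariate vertices X, and let X_M ⊆ X. Write Ch(Y) for the children of Y, De(A) for the set of vertices reachable from the set A by a directed path of length ≥ 1, X_M⁰ := X_M ∩ Ch(Y), X_S := X ∖ X_M, and X_do* := X_M⁰ ∪ (De(X_M⁰) ∖ Ch(Y)). Then: (i) De(X_do*) ∖ X_do* = De(X_M⁰) ∩ X_S ∩ Ch(Y); and (ii) for every X_do ⊆ X with X_M⁰ ⊆ X_do and X_do ∩ (X_S ∩ Ch(Y)) = ∅, one has De(X_do*) ∖ X_do* ⊆ De(X_do) ∖ X_do. In other words, X_do* achieves the minimum regeneration set among all such X_do. -/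
/-- Let `G` be a finite DAG over a target `Y` and covariates
`X = V ∖ {Y}`, and let `X_M ⊆ X`. With `X_M⁰ := X_M ∩ Ch(Y)`, `X_S := X ∖ X_M` and
`X_do* := X_M⁰ ∪ (De(X_M⁰) ∖ Ch(Y))`, one has
(i) `De(X_do*) ∖ X_do* = De(X_M⁰) ∩ X_S ∩ Ch(Y)`, and
(ii) for every `X_do ⊆ X` with `X_M⁰ ⊆ X_do` and `X_do ∩ (X_S ∩ Ch(Y)) = ∅`, it holds
that `De(X_do*) ∖ X_do* ⊆ De(X_do) ∖ X_do`; i.e. `X_do*` achieves the minimum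
regeneration set among all such `X_do`. -/
theorem minimum_regeneration_set {V : Type*} [Fintype V]
    (G : FinDAG V) (y0 : V) (XM : Set V) (hXM : y0 ∉ XM) :
    let Ch : Set V := {v | G.edge y0 v}
    let De : Set V → Set V := fun A => {v | ∃ a ∈ A, Relation.TransGen G.edge a v}
    let X : Set V := {v | v ≠ y0}
    let XM0 : Set V := XM ∩ Ch
    let XS : Set V := X \ XM
    let Xdo : Set V := XM0 ∪ (De XM0 \ Ch)
    (De Xdo \ Xdo = De XM0 ∩ XS ∩ Ch) ∧
    (∀ Xdo' : Set V, Xdo' ⊆ X → XM0 ⊆ Xdo' → Xdo' ∩ (XS ∩ Ch) = ∅ →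
      De Xdo \ Xdo ⊆ De Xdo' \ Xdo') := by
  intro Ch De X XM0 XS Xdo
  have key : De Xdo \ Xdo = De XM0 ∩ XS ∩ Ch := by
    ext v
    constructor
    · rintro ⟨⟨a, ha, hav⟩, hv⟩
      have hD : v ∈ De XM0 := by
        rcases ha with ha | ⟨⟨b, hb, hba⟩, _⟩
        · exact ⟨a, ha, hav⟩
        · exact ⟨b, hb, hba.trans hav⟩
      have hC : v ∈ Ch := by
        by_contra hC
        exact hv (Or.inr ⟨hD, hC⟩)
      refine ⟨⟨hD, ?_, fun hM => hv (Or.inl ⟨hM, hC⟩)⟩, hC⟩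
      intro hvy
      subst hvy
      exact G.acyclic _ (Relation.TransGen.single hC)
    · rintro ⟨⟨⟨a, ha, hav⟩, hS⟩, hC⟩
      refine ⟨⟨a, Or.inl ha, hav⟩, ?_⟩
      rintro (h | h)
      · exact hS.2 h.1
      · exact h.2 hC
  refine ⟨key, ?_⟩
  intro Xdo' _ hsub hdisj
  rw [key]
  rintro v ⟨⟨⟨a, ha, hav⟩, hS⟩, hC⟩
  refine ⟨⟨a, hsub ha, hav⟩, fun hv => ?_⟩
  have h : v ∈ Xdo' ∩ (XS ∩ Ch) := ⟨hv, hS, hC⟩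
  rw [hdisj] at h
  exact h
end

section
/- Let G be a finite DAG, let V^i and V^j be disjoint vertex sets, and let p be a path in G between vertices V_1 and V_l, where V_1 ∉ V^i ∪ V^j. If p is blocked by V^i but p is not blocked by V^i ∪ V^j, then V_1 is not d-separated from V^j given V^i; that is, there exists a path in G between V_1 and some vertex of V^j that is not blocked by V^i. -/
/-- A finite directed acyclic graph on a vertex type `V`: an edge relation with no
directed cycles. -/
structure DAG (V : Type*) where
  edge : V → V → Prop
  acyclic : ∀ v, ¬ Relation.TransGen edge v v

/-- A path: a sequence of at least two distinct vertices in which consecutive vertices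
are joined by an edge (in either direction). -/
def IsPath {V : Type*} (E : V → V → Prop) (p : List V) : Prop :=
  2 ≤ p.length ∧ p.Nodup ∧
    ∀ i, ∀ h : i + 1 < p.length,
      E (p.get ⟨i, Nat.lt_of_succ_lt h⟩) (p.get ⟨i + 1, h⟩) ∨
      E (p.get ⟨i + 1, h⟩) (p.get ⟨i, Nat.lt_of_succ_lt h⟩)

/-- The vertex at position `i` of the path `p` is a collider on `p`: it is an interior
vertex and both adjacent edges of the path point into it. -/
def IsColliderAt {V : Type*} (E : V → V → Prop) (p : List V) (i : ℕ) : Prop :=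
  ∃ (h1 : 1 ≤ i) (h2 : i + 1 < p.length),
    E (p.get ⟨i - 1, by omega⟩) (p.get ⟨i, by omega⟩) ∧
    E (p.get ⟨i + 1, h2⟩) (p.get ⟨i, by omega⟩)

/-- A path is blocked by a vertex set `Z` if it contains a non-collider belonging to
`Z`, or a collider such that neither the collider itself nor any of its descendants
belongs to `Z`. -/
def Blocked {V : Type*} (E : V → V → Prop) (Z : Set V) (p : List V) : Prop :=
  (∃ i, ∃ h : i < p.length, ¬ IsColliderAt E p i ∧ p.get ⟨i, h⟩ ∈ Z) ∨
  (∃ i, ∃ h : i < p.length, IsColliderAt E p i ∧ p.get ⟨i, h⟩ ∉ Z ∧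
    ∀ w, Relation.TransGen E (p.get ⟨i, h⟩) w → w ∉ Z)

/-- `p` is a path between the vertices `u` and `v`. -/
def PathBetween {V : Type*} (E : V → V → Prop) (p : List V) (u v : V) : Prop :=
  IsPath E p ∧ p.head? = some u ∧ p.getLast? = some v

/-- `A` is d-separated from `B` given `Z`: every path between a vertex of `A` and a
vertex of `B` is blocked by `Z`. -/
def DSep {V : Type*} (E : V → V → Prop) (A B Z : Set V) : Prop :=
  ∀ (p : List V) (u v : V), PathBetween E p u v → u ∈ A → v ∈ B → Blocked E Z p

theorem exists_directed_list {V : Type*} (G : DAG V) (x v : V)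
    (h : Relation.ReflTransGen G.edge x v) :
    ∃ t : List V, (x :: t).getLast? = some v ∧ (x :: t).Nodup ∧
      (∀ j, ∀ h : j + 1 < (x :: t).length, G.edge ((x :: t)[j]'(Nat.lt_of_succ_lt h)) ((x :: t)[j + 1]'h)) ∧
      ∀ y ∈ (x :: t), Relation.ReflTransGen G.edge x y ∧ Relation.ReflTransGen G.edge y v := by
  induction h using Relation.ReflTransGen.head_induction_on with
  | refl =>
    refine ⟨[], by simp, by simp, ?_, ?_⟩
    · intro j h; simp at h
    · intro y hy
      simp at hy
      subst hy
      exact ⟨.refl, .refl⟩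
  | head hab hbv ih =>
    rename_i a b
    obtain ⟨t, h1, h2, h3, h4⟩ := ih
    refine ⟨b :: t, by simpa using h1, ?_, ?_, ?_⟩
    · rw [List.nodup_cons]
      refine ⟨fun hm => ?_, h2⟩
      exact G.acyclic a (Relation.TransGen.head' hab (h4 a hm).1)
    · intro j h
      cases j with
      | zero => simpa using hab
      | succ j =>
        have := h3 j (by simpa using h)
        simpa using this
    · intro y hy
      rw [List.mem_cons] at hy
      rcases hy with rfl | hy
      · exact ⟨.refl, .head hab hbv⟩
      · exact ⟨.head hab (h4 y hy).1, (h4 y hy).2⟩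

/-- Let `G` be a finite DAG, `Vⁱ, Vʲ` disjoint vertex sets, and `p` a
path between `V₁` and `V_l` with `V₁ ∉ Vⁱ ∪ Vʲ`. If `p` is blocked by `Vⁱ` but not
blocked by `Vⁱ ∪ Vʲ`, then `V₁` is not d-separated from `Vʲ` given `Vⁱ`: there is a path
between `V₁` and a vertex of `Vʲ` that is not blocked by `Vⁱ`. -/
theorem not_dsep_of_unblocked_by_union {V : Type*} [Fintype V] (G : DAG V)
    (Vi Vj : Set V) (hdisj : Disjoint Vi Vj)
    (p : List V) (u w : V) (hp : PathBetween G.edge p u w)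
    (hu : u ∉ Vi ∪ Vj)
    (hblocked : Blocked G.edge Vi p)
    (hnot : ¬ Blocked G.edge (Vi ∪ Vj) p) :
    ∃ (q : List V) (v : V), PathBetween G.edge q u v ∧ v ∈ Vj ∧ ¬ Blocked G.edge Vi q := by
  classical
  obtain ⟨⟨hlen, hnd, hedge⟩, hhead, hlast⟩ := hp
  simp only [Blocked, List.get_eq_getElem] at hnot hblocked hedge ⊢
  have hN : ∀ i, ∀ h : i < p.length, ¬ IsColliderAt G.edge p i → p[i] ∉ Vi ∪ Vj :=
    fun i h hc hm => hnot (Or.inl ⟨i, h, hc, hm⟩)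
  -- first closed collider
  have hex : ∃ i, ∃ h : i < p.length, IsColliderAt G.edge p i ∧ p[i] ∉ Vi ∧
      ∀ w, Relation.TransGen G.edge p[i] w → w ∉ Vi := by
    rcases hblocked with ⟨i, h, hc, hm⟩ | h
    · exact absurd (Or.inl hm) (hN i h hc)
    · exact h
  obtain ⟨hk, hkc, hkV, hkd⟩ := Nat.find_spec hex
  have hkmin := fun i hi => Nat.find_min hex (m := i) hi
  generalize Nat.find hex = k at *
  have hdesc : ∀ y, Relation.ReflTransGen G.edge p[k] y → y ∉ Vi := by
    intro y hy
    rcases Relation.reflTransGen_iff_eq_or_transGen.1 hy with rfl | hy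
    · exact hkV
    · exact hkd y hy
  obtain ⟨v, hv, hkv⟩ : ∃ v ∈ Vj, Relation.ReflTransGen G.edge p[k] v := by
    by_contra hcon
    push Not at hcon
    refine hnot (Or.inr ⟨k, hk, hkc, ?_, ?_⟩)
    · rintro (h | h)
      · exact hkV h
      · exact hcon _ h .refl
    · rintro w hw (h | h)
      · exact hkd w hw h
      · exact hcon _ h hw.to_reflTransGen
  -- first vertex of `p` lying between `p[k]` and `v`
  have hex2 : ∃ m, ∃ h : m < p.length, Relation.ReflTransGen G.edge p[k] p[m] ∧
      Relation.ReflTransGen G.edge p[m] v := ⟨k, hk, .refl, hkv⟩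
  obtain ⟨hm, hkm, hmv⟩ := Nat.find_spec hex2
  have hmk : Nat.find hex2 ≤ k := Nat.find_min' hex2 ⟨hk, .refl, hkv⟩
  have hmmin := fun i hi => Nat.find_min hex2 (m := i) hi
  generalize Nat.find hex2 = m at *
  obtain ⟨t, hl1, hl2, hl3, hl4⟩ := exists_directed_list G p[m] v hmv
  have hl0 : ∀ h : 0 < (p[m] :: t).length, (p[m] :: t)[0]'h = p[m] := fun _ => rfl
  have hlpos : 0 < (p[m] :: t).length := by simp
  have hu0 : p[0] = u := by
    rw [List.head?_eq_getElem?, List.getElem?_eq_getElem (by omega)] at hhead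
    exact Option.some.inj hhead
  have hne : m = 0 → 2 ≤ (p[m] :: t).length := by
    intro h0
    subst h0
    cases t with
    | nil =>
      simp at hl1
      exact absurd (Or.inr (hu0 ▸ hl1 ▸ hv)) hu
    | cons a b => simp
  generalize (p[m] :: t) = l at *
  obtain ⟨q, hq⟩ : ∃ q, q = p.take m ++ l := ⟨_, rfl⟩
  have hql : q.length = m + l.length := by subst hq; simp; omega
  have hq1 : ∀ i, ∀ h : i < q.length, ∀ hi : i ≤ m, q[i] = p[i]'(by omega) := by
    subst hq
    intro i h him
    rcases Nat.lt_or_eq_of_le him with h1 | rfl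
    · rw [List.getElem_append_left (by simp; omega), List.getElem_take]
    · rw [List.getElem_append_right (by simp)]
      simpa [Nat.min_eq_left hm.le] using hl0 hlpos
  have hq2 : ∀ i, ∀ h : i < q.length, ∀ hi : m ≤ i,
      q[i] = l[i - m]'(by omega) := by
    subst hq
    intro i h him
    rw [List.getElem_append_right (by simp; omega)]
    simp [Nat.min_eq_left hm.le]
  have hqnd : q.Nodup := by
    subst hq
    rw [List.nodup_append']
    refine ⟨hnd.sublist (List.take_sublist _ _), hl2, ?_⟩
    intro y hy1 hy2
    obtain ⟨i, hi, rfl⟩ := List.mem_iff_getElem.1 hy1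
    rw [List.getElem_take] at hy2
    have him : i < m := by simp at hi; omega
    exact hmmin i him ⟨by omega, hkm.trans (hl4 _ hy2).1, (hl4 _ hy2).2⟩
  have hqlast : q.getLast? = some v := by
    subst hq
    rw [List.getLast?_append, hl1]; rfl
  have hqe : ∀ i, ∀ h : i + 1 < q.length, m ≤ i → G.edge q[i] q[i + 1] := by
    intro i h him
    have := hl3 (i - m) (by omega)
    rw [hq2 i (by omega) him, hq2 (i + 1) h (by omega)]
    simpa only [show i + 1 - m = i - m + 1 by omega] using this
  have hc1 : ∀ i, i < m → (IsColliderAt G.edge q i ↔ IsColliderAt G.edge p i) := by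
    intro i him
    simp only [IsColliderAt, List.get_eq_getElem]
    constructor
    · rintro ⟨h1, h2, h3, h4⟩
      refine ⟨h1, by omega, ?_, ?_⟩
      · rwa [hq1 (i - 1) (by omega) (by omega), hq1 i (by omega) (by omega)] at h3
      · rwa [hq1 (i + 1) (by omega) (by omega), hq1 i (by omega) (by omega)] at h4
    · rintro ⟨h1, h2, h3, h4⟩
      refine ⟨h1, by omega, ?_, ?_⟩
      · rwa [hq1 (i - 1) (by omega) (by omega), hq1 i (by omega) (by omega)]
      · rwa [hq1 (i + 1) (by omega) (by omega), hq1 i (by omega) (by omega)]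
  have hc2 : ∀ i, m ≤ i → ¬ IsColliderAt G.edge q i := by
    rintro i him ⟨h1, h2, h3, h4⟩
    exact G.acyclic _ ((Relation.TransGen.single (hqe i h2 him)).tail h4)
  refine ⟨q, v, ⟨⟨?_, hqnd, ?_⟩, ?_, hqlast⟩, hv, ?_⟩
  · by_cases h0 : m = 0
    · have := hne h0
      omega
    · omega
  · intro i h
    simp only [List.get_eq_getElem]
    by_cases him : m ≤ i
    · exact Or.inl (hqe i h him)
    · rw [hq1 i (by omega) (by omega), hq1 (i + 1) h (by omega)]
      exact hedge i (by omega)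
  · rw [List.head?_eq_getElem?, List.getElem?_eq_getElem (by omega), hq1 0 (by omega) (by omega), hu0]
  · rintro (⟨i, h, hc, hi⟩ | ⟨i, h, hc, hi, hd⟩)
    · by_cases him : m ≤ i
      · rw [hq2 i h him] at hi
        exact hdesc _ (hkm.trans (hl4 _ (List.getElem_mem _)).1) hi
      · rw [hc1 i (by omega)] at hc
        rw [hq1 i h (by omega)] at hi
        exact hN i (by omega) hc (Or.inl hi)
    · by_cases him : m ≤ i
      · exact hc2 i him hc
      · rw [hc1 i (by omega)] at hc
        rw [hq1 i h (by omega)] at hi hd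
        exact hkmin i (by omega) ⟨by omega, hc, hi, hd⟩
end

section
/- Let G be a DAG over a target vertex Y and covariate vertices X_1, …, X_d. For subsets S′, S″ ⊆ {1, …, d}, define S′ ∼_G S″ if and only if there exists S_∩ ⊆ S′ ∩ S″ such that Y is d-separated from X_{(S′ ∪ S″) ∖ S_∩} given X_{S_∩} in G (where X_A denotes the set of covariates indexed by A). Then ∼_G is an equivalence relation on the power set of {1, …, d}: it is reflexive, symmetric, and — nontrivially — transitive: if S¹ ∼_G S² and S² ∼_G S³, then S¹ ∼_G S³. -/
/-- The set of covariate vertices (in `Option ι`, the target is `none` and the covariate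
with index `i` is `some i`) indexed by a finite index set `S`. -/
def XSet {ι : Type*} (S : Finset ι) : Set (Option ι) := {v | ∃ i ∈ S, v = some i}

/-- The equivalence relation `∼_G` on subsets of the covariate index set: `S' ∼_G S''`
iff there is `S_∩ ⊆ S' ∩ S''` such that the target `Y` (= `none`) is d-separated from
`X_{(S' ∪ S'') ∖ S_∩}` given `X_{S_∩}` in `G`. -/
def SimG {ι : Type*} [DecidableEq ι] (G : DAG (Option ι)) (S' S'' : Finset ι) : Prop :=
  ∃ Scap : Finset ι, Scap ⊆ S' ∩ S'' ∧
    DSep G.edge {none} (XSet ((S' ∪ S'') \ Scap)) (XSet Scap)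

/-- `N_G`: the number of equivalence classes of `∼_G`. -/
noncomputable def NG {ι : Type*} [DecidableEq ι] (G : DAG (Option ι)) : ℕ :=
  Nat.card (Quot (SimG G))

/-- Adjacency in the skeleton of a DAG. -/
def SkelAdj {V : Type*} (G : DAG V) (a b : V) : Prop := G.edge a b ∨ G.edge b a

theorem take_active {V : Type*} (E : V → V → Prop) (p : List V) (u v : V) (A C W : Set V)
    (hp : PathBetween E p u v) (hb : ¬ Blocked E C p) (n : ℕ) (hn : n < p.length) (h1 : 1 ≤ n)
    (hW : ∀ i, ∀ h : i < n, p[i] ∉ W) (hCA : C ⊆ A) (hAW : ∀ x ∈ A, x ∉ C → x ∈ W)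
    (hnA : p[n] ∉ A) :
    PathBetween E (p.take (n+1)) u p[n] ∧ ¬ Blocked E A (p.take (n+1)) := by
  obtain ⟨⟨hl, hnd, hadj⟩, hu, hv⟩ := hp
  have hlen : (p.take (n+1)).length = n + 1 := by simp; omega
  have hcol : ∀ i, IsColliderAt E (p.take (n+1)) i ↔ (i < n ∧ IsColliderAt E p i) := by
    intro i
    constructor
    · rintro ⟨a, b, c, d⟩
      rw [hlen] at b
      refine ⟨by omega, a, by omega, ?_, ?_⟩
      · simpa using c
      · simpa using d
    · rintro ⟨hi, a, b, c, d⟩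
      refine ⟨a, by omega, ?_, ?_⟩
      · simpa using c
      · simpa using d
  refine ⟨⟨⟨by omega, hnd.sublist (List.take_sublist _ _), ?_⟩, ?_, ?_⟩, ?_⟩
  · intro i h
    have := hadj i (by omega)
    simpa using this
  · rw [List.head?_take]
    simpa using hu
  · rw [List.getLast?_eq_getElem?, hlen]
    simp [hn]
  · rintro (⟨i, h, hc, hA⟩ | ⟨i, h, hc, hA, hD⟩)
    · rw [hcol] at hc
      have hA' : p[i]'(by omega) ∈ A := by simpa using hA
      have hin : i < n := by
        rcases Nat.lt_or_ge i n with h' | h'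
        · exact h'
        · have : i = n := by omega
          subst this
          exact absurd hA' hnA
      by_cases hC : p[i]'(by omega) ∈ C
      · exact hb (Or.inl ⟨i, by omega, fun hh => hc ⟨hin, hh⟩, hC⟩)
      · exact hW i hin (hAW _ hA' hC)
    · rw [hcol] at hc
      refine hb (Or.inr ⟨i, by omega, hc.2, fun hh => hA ?_, fun w hw hwC => hD w ?_ (hCA hwC)⟩)
      · simpa using hCA hh
      · simpa using hw

theorem simG_trans {ι : Type*} [DecidableEq ι] (G : DAG (Option ι)) {S₁ S₂ S₃ : Finset ι}
    (h12 : SimG G S₁ S₂) (h23 : SimG G S₂ S₃) : SimG G S₁ S₃ := by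
  classical
  obtain ⟨A, hA, dA⟩ := h12
  obtain ⟨B, hB, dB⟩ := h23
  refine ⟨A ∩ B, by grind, ?_⟩
  rintro p u v hp hu hv
  by_contra hb
  obtain rfl : u = none := hu
  let W : Set (Option ι) := XSet ((S₁ ∪ S₂ ∪ S₃) \ (A ∩ B))
  have hex : ∃ n, ∃ h : n < p.length, p[n] ∈ W := by
    have h0 := hp.1.1
    refine ⟨p.length - 1, by omega, ?_⟩
    have hl := hp.2.2
    rw [List.getLast?_eq_getElem?, List.getElem?_eq_some_iff] at hl
    obtain ⟨h, e⟩ := hl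
    rw [e]
    obtain ⟨i, hi, rfl⟩ := hv
    exact ⟨i, by grind, rfl⟩
  obtain ⟨hn, hw⟩ := Nat.find_spec hex
  have hmin := fun i (h : i < Nat.find hex) => Nat.find_min hex h
  generalize Nat.find hex = n at hn hw hmin
  have hW : ∀ i, ∀ h : i < n, p[i] ∉ W := fun i h h' => hmin i h ⟨by omega, h'⟩
  obtain ⟨j, hj, hjn⟩ := hw
  have h1 : 1 ≤ n := by
    rcases Nat.eq_zero_or_pos n with h | h
    · subst h
      have hh := hp.2.1
      rw [List.head?_eq_getElem?, List.getElem?_eq_some_iff] at hh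
      obtain ⟨_, e⟩ := hh
      rw [e] at hjn
      cases hjn
    · exact h
  have key : ∀ D : Finset ι, A ∩ B ⊆ D → D ⊆ S₂ → j ∉ D →
      PathBetween G.edge (p.take (n+1)) none p[n] ∧
        ¬ Blocked G.edge (XSet D) (p.take (n+1)) := by
    intro D hD hD2 hjD
    refine take_active G.edge p none v (XSet D) (XSet (A ∩ B)) W hp hb n hn h1 hW ?_ ?_ ?_
    · rintro _ ⟨i, hi, rfl⟩
      exact ⟨i, hD hi, rfl⟩
    · rintro _ ⟨i, hi, rfl⟩ hC
      refine ⟨i, ?_, rfl⟩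
      have : i ∉ A ∩ B := fun h => hC ⟨i, h, rfl⟩
      have := hD2 hi
      grind
    · rintro ⟨i, hi, e⟩
      rw [hjn] at e
      cases e
      exact hjD hi
  by_cases hc : j ∉ A ∧ j ∈ S₁ ∪ S₂
  · obtain ⟨k1, k2⟩ := key A (by grind) (by grind) hc.1
    exact k2 (dA _ _ _ k1 rfl ⟨j, by grind, hjn⟩)
  · have hjB : j ∉ B := by grind
    obtain ⟨k1, k2⟩ := key B (by grind) (by grind) hjB
    exact k2 (dB _ _ _ k1 rfl ⟨j, by grind, hjn⟩)

/-- For a DAG `G` over a target `Y` and covariates `X_1, …, X_d`, the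
relation `∼_G` is an equivalence relation on the power set of `{1, …, d}`: reflexive,
symmetric and transitive. -/
theorem simG_equivalence {d : ℕ} (G : DAG (Option (Fin d))) :
    Equivalence (SimG G) := by
  refine ⟨fun S => ⟨S, by simp, ?_⟩, ?_, fun h h' => simG_trans G h h'⟩
  · rintro p u v - - ⟨i, hi, -⟩
    simp at hi
  · rintro S T ⟨C, hC, h⟩
    exact ⟨C, by rwa [Finset.inter_comm], by rwa [Finset.union_comm]⟩
end

section
/- Let G₀ and G₁ be DAGs over the same target vertex Y and covariate vertices X_1, …, X_d such that every directed edge of G₀ is a directed edge of G₁. Then for all subsets S′, S″ ⊆ {1, …, d}: if S′ ≁_{G₀} S″ then S′ ≁_{G₁} S″. Consequently N_{G₀} ≤ N_{G₁}: adding an edge does not decrease the number of equivalence classes, and deleting an edge does not increase it. -/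
theorem edge_reflect {V : Type*} (G₀ G₁ : DAG V)
    (hsub : ∀ a b, G₀.edge a b → G₁.edge a b) {a b : V}
    (h : G₀.edge a b ∨ G₀.edge b a) (h1 : G₁.edge a b) : G₀.edge a b := by
  rcases h with h | h
  · exact h
  · exact absurd ((Relation.TransGen.single h1).tail (hsub _ _ h)) (G₁.acyclic a)

theorem isColliderAt_iff_of_sub {V : Type*} (G₀ G₁ : DAG V)
    (hsub : ∀ a b, G₀.edge a b → G₁.edge a b) {p : List V} (hp : IsPath G₀.edge p) (i : ℕ) :
    IsColliderAt G₀.edge p i ↔ IsColliderAt G₁.edge p i := by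
  constructor
  · rintro ⟨h1, h2, ha, hb⟩
    exact ⟨h1, h2, hsub _ _ ha, hsub _ _ hb⟩
  · rintro ⟨h1, h2, ha, hb⟩
    refine ⟨h1, h2, edge_reflect G₀ G₁ hsub ?_ ha, edge_reflect G₀ G₁ hsub ?_ hb⟩
    · obtain ⟨j, rfl⟩ : ∃ j, i = j + 1 := ⟨i - 1, by omega⟩
      exact hp.2.2 j (by omega)
    · exact (hp.2.2 i h2).symm

theorem dSep_of_sub {V : Type*} (G₀ G₁ : DAG V)
    (hsub : ∀ a b, G₀.edge a b → G₁.edge a b) {A B Z : Set V}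
    (h : DSep G₁.edge A B Z) : DSep G₀.edge A B Z := by
  rintro p u v ⟨hp, hu, hv⟩ hA hB
  have hp1 : IsPath G₁.edge p :=
    ⟨hp.1, hp.2.1, fun i hi => (hp.2.2 i hi).imp (hsub _ _) (hsub _ _)⟩
  rcases h p u v ⟨hp1, hu, hv⟩ hA hB with ⟨i, hi, hc, hz⟩ | ⟨i, hi, hc, hz, hd⟩
  · exact Or.inl ⟨i, hi, fun hh => hc ((isColliderAt_iff_of_sub G₀ G₁ hsub hp i).1 hh), hz⟩
  · exact Or.inr ⟨i, hi, (isColliderAt_iff_of_sub G₀ G₁ hsub hp i).2 hc, hz,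
      fun w hw => hd w (Relation.TransGen.mono hsub _ _ hw)⟩

theorem simG_of_sub {ι : Type*} [DecidableEq ι] (G₀ G₁ : DAG (Option ι))
    (hsub : ∀ a b, G₀.edge a b → G₁.edge a b) (S' S'' : Finset ι)
    (h : SimG G₁ S' S'') : SimG G₀ S' S'' := by
  obtain ⟨T, hT, hd⟩ := h
  exact ⟨T, hT, dSep_of_sub G₀ G₁ hsub hd⟩

/-- Let `G₀, G₁` be DAGs over the same target `Y` and covariates
`X_1, …, X_d` with every edge of `G₀` an edge of `G₁`. Then inequivalence transfers from
`G₀` to `G₁` (`S' ≁_{G₀} S'' → S' ≁_{G₁} S''`) and consequently `N_{G₀} ≤ N_{G₁}`: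
adding an edge does not decrease the number of equivalence classes, and deleting an edge
does not increase it. -/
theorem NG_monotone_in_edges {d : ℕ} (G₀ G₁ : DAG (Option (Fin d)))
    (hsub : ∀ a b, G₀.edge a b → G₁.edge a b) :
    (∀ S' S'' : Finset (Fin d), ¬ SimG G₀ S' S'' → ¬ SimG G₁ S' S'') ∧
    NG G₀ ≤ NG G₁ := by
  refine ⟨fun S' S'' h h1 => h (simG_of_sub G₀ G₁ hsub S' S'' h1), ?_⟩
  have : Finite (Quot (SimG G₁)) := Finite.of_surjective (Quot.mk _) Quot.mk_surjective
  refine Nat.card_le_card_of_surjective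
    (Quot.map id (simG_of_sub G₀ G₁ hsub) : Quot (SimG G₁) → Quot (SimG G₀)) ?_
  rintro ⟨S⟩
  exact ⟨Quot.mk _ S, rfl⟩
end

section
/- Let d ≥ 1 and let G be any DAG on vertices Y, X_d, X_{d−1}, …, X_1 whose skeleton is the path Y − X_d − X_{d−1} − ⋯ − X_1 (that is, G is an acyclic orientation of this path graph). Then N_G = d + 1. -/
/-- Adjacency of the path (chain) skeleton `Y − X_d − X_{d−1} − ⋯ − X_1`, where the
covariate `X_j` is represented by the index `j - 1 : Fin d` and `Y` by `none`. -/
def chainAdj (d : ℕ) : Option (Fin d) → Option (Fin d) → Prop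
  | some i, some j => (i : ℕ) + 1 = (j : ℕ) ∨ (j : ℕ) + 1 = (i : ℕ)
  | none, some i => (i : ℕ) = d - 1
  | some i, none => (i : ℕ) = d - 1
  | none, none => False

open Classical in
/-- The vertex at position `k` of the chain. -/
noncomputable def chV (d k : ℕ) : Option (Fin d) :=
  if h : 1 ≤ k ∧ k ≤ d then some ⟨d - k, by omega⟩ else none

/-- Position `k` is a collider of the chain. -/
def chC {d : ℕ} (E : Option (Fin d) → Option (Fin d) → Prop) (k : ℕ) : Prop :=
  1 ≤ k ∧ k + 1 ≤ d ∧ E (chV d (k - 1)) (chV d k) ∧ E (chV d (k + 1)) (chV d k)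

lemma chV_zero (d : ℕ) : chV d 0 = none := by simp [chV]

lemma chV_pos {d k : ℕ} (h1 : 1 ≤ k) (h2 : k ≤ d) :
    chV d k = some ⟨d - k, by omega⟩ := by
  simp [chV, h1, h2]

lemma chV_big {d k : ℕ} (h2 : d < k) : chV d k = none := by
  unfold chV; rw [dif_neg]; omega

lemma chV_sub {d : ℕ} (i : Fin d) : chV d (d - i) = some i := by
  have := i.2
  rw [chV_pos (by omega) (by omega)]
  congr 1
  ext; simp; omega

lemma mem_XSet_some {ι : Type*} (S : Finset ι) (i : ι) : some i ∈ XSet S ↔ i ∈ S := by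
  simp [XSet]

lemma none_not_mem_XSet {ι : Type*} (S : Finset ι) : none ∉ XSet S := by
  simp [XSet]

lemma chV_inj {d i j : ℕ} (hi : i ≤ d) (hj : j ≤ d) (h : chV d i = chV d j) : i = j := by
  unfold chV at h
  split_ifs at h <;> simp at h <;> omega

lemma chAdj_next {d i : ℕ} (hi : i ≤ d) (b : Option (Fin d)) (h : chainAdj d (chV d i) b) :
    (i + 1 ≤ d ∧ b = chV d (i + 1)) ∨ (1 ≤ i ∧ b = chV d (i - 1)) := by
  rcases Nat.eq_zero_or_pos i with rfl | hi0
  · rw [chV_zero] at h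
    cases b with
    | none => exact h.elim
    | some j =>
      have hj := j.2
      have h' : (j : ℕ) = d - 1 := h
      left
      refine ⟨by omega, ?_⟩
      rw [← chV_sub j]; congr 1; omega
  · rw [chV_pos hi0 hi] at h
    cases b with
    | none =>
      have h' : d - i = d - 1 := h
      right
      refine ⟨hi0, ?_⟩
      have : i - 1 = 0 := by omega
      rw [this, chV_zero]
    | some j =>
      have hj := j.2
      have h' : d - i + 1 = (j : ℕ) ∨ (j : ℕ) + 1 = d - i := h
      rw [← chV_sub j]
      rcases h' with h' | h'
      · right; refine ⟨hi0, ?_⟩; congr 1; omega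
      · left; refine ⟨by omega, ?_⟩; congr 1; omega

lemma chAdj_succ {d i : ℕ} (hi : i + 1 ≤ d) : chainAdj d (chV d i) (chV d (i + 1)) := by
  rw [chV_pos (k := i + 1) (by omega) hi]
  rcases Nat.eq_zero_or_pos i with rfl | hi0
  · rw [chV_zero]; simp [chainAdj]
  · rw [chV_pos hi0 (by omega)]; simp only [chainAdj]; omega

section
variable {d : ℕ} (G : DAG (Option (Fin d)))

lemma ch_path_get (hskel : ∀ a b, SkelAdj G a b ↔ chainAdj d a b) {p : List (Option (Fin d))}
    (hp : IsPath G.edge p) (hh : p.head? = some none) :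
    ∀ i, ∀ h : i < p.length, i ≤ d ∧ p.get ⟨i, h⟩ = chV d i := by
  intro i
  induction i using Nat.strong_induction_on with
  | _ i ih =>
  intro h
  rcases i with _ | i
  · refine ⟨by omega, ?_⟩
    rw [chV_zero]
    cases p with
    | nil => simp at h
    | cons a l => simpa using hh
  · obtain ⟨h1, h2⟩ := ih i (by omega) (by omega)
    have hadj : chainAdj d (chV d i) (p.get ⟨i + 1, h⟩) := by
      rw [← hskel, ← h2]; exact hp.2.2 i h
    rcases chAdj_next h1 _ hadj with h3 | h3
    · exact h3
    · exfalso
      obtain ⟨h4, h5⟩ := ih (i - 1) (by omega) (by omega)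
      rw [← h5] at h3
      have := (List.nodup_iff_injective_get.mp hp.2.1) h3.2
      simp at this
      omega

lemma ch_no_desc (hskel : ∀ a b, SkelAdj G a b ↔ chainAdj d a b) {k : ℕ} (hk : chC G.edge k)
    (w : Option (Fin d)) : ¬ Relation.TransGen G.edge (chV d k) w := by
  intro h
  obtain ⟨c, hc⟩ : ∃ c, G.edge (chV d k) c := by
    rw [Relation.TransGen.head'_iff] at h
    obtain ⟨c, hc, -⟩ := h
    exact ⟨c, hc⟩
  obtain ⟨h1, h2, h3, h4⟩ := hk
  have hc2 : G.edge c (chV d k) := by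
    rcases chAdj_next (by omega) c ((hskel _ _).1 (Or.inl hc)) with ⟨_, rfl⟩ | ⟨_, rfl⟩
    · exact h4
    · exact h3
  exact G.acyclic _ ((Relation.TransGen.single hc).tail hc2)

/-- On a path starting from the target, colliders are chain colliders. -/
lemma ch_collider_iff {p : List (Option (Fin d))}
    (hg : ∀ i, ∀ h : i < p.length, i ≤ d ∧ p.get ⟨i, h⟩ = chV d i) (i : ℕ) :
    IsColliderAt G.edge p i ↔ (i + 1 < p.length ∧ chC G.edge i) := by
  constructor
  · rintro ⟨h1, h2, h3, h4⟩
    rw [(hg _ _).2, (hg _ _).2] at h3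
    rw [(hg _ _).2, (hg _ _).2] at h4
    exact ⟨h2, h1, (hg _ h2).1, h3, h4⟩
  · rintro ⟨h2, h1, h5, h3, h4⟩
    refine ⟨h1, h2, ?_, ?_⟩
    · rw [(hg _ _).2, (hg _ _).2]; exact h3
    · rw [(hg _ _).2, (hg _ _).2]; exact h4

/-- The path from the target to position `a`. -/
noncomputable def chP (d a : ℕ) : List (Option (Fin d)) := (List.range (a + 1)).map (chV d)

lemma chP_get {a : ℕ} (ha : a ≤ d) :
    ∀ i, ∀ h : i < (chP d a).length, i ≤ d ∧ (chP d a).get ⟨i, h⟩ = chV d i := by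
  intro i h
  refine ⟨?_, by simp [chP]⟩
  simp [chP] at h; omega

lemma chP_path (hskel : ∀ a b, SkelAdj G a b ↔ chainAdj d a b) {a : ℕ} (h1 : 1 ≤ a)
    (ha : a ≤ d) : PathBetween G.edge (chP d a) none (chV d a) := by
  refine ⟨⟨by simp [chP]; omega, ?_, ?_⟩, ?_, ?_⟩
  · refine List.Nodup.map_on ?_ List.nodup_range
    intro x hx y hy hxy
    simp at hx hy
    exact chV_inj (by omega) (by omega) hxy
  · intro i h
    have h' := (chP_get ha _ h).1
    rw [(chP_get ha _ _).2, (chP_get ha _ _).2]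
    exact (hskel _ _).2 (chAdj_succ h')
  · simp [chP, List.range_succ_eq_map, chV_zero]
  · simp [chP, List.range_succ]

/-- `k` is the position of a blocker for the chain given `S`. -/
def chB (S : Finset (Fin d)) (k : ℕ) : Prop :=
  k = d + 1 ∨ ¬ (chV d k ∈ XSet S ↔ chC G.edge k)

lemma chB_ex (S : Finset (Fin d)) : ∃ k, chB G S k := ⟨d + 1, Or.inl rfl⟩

open Classical in
/-- First blocker. -/
noncomputable def chF (S : Finset (Fin d)) : ℕ := Nat.find (chB_ex G S)

lemma chF_spec (S : Finset (Fin d)) : chB G S (chF G S) := by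
  classical exact Nat.find_spec (chB_ex G S)

lemma chF_min (S : Finset (Fin d)) {k : ℕ} (h : k < chF G S) :
    k ≠ d + 1 ∧ (chV d k ∈ XSet S ↔ chC G.edge k) := by
  classical
  have := Nat.find_min (chB_ex G S) h
  unfold chB at this
  tauto

lemma chF_le (S : Finset (Fin d)) : chF G S ≤ d + 1 := by
  classical exact Nat.find_min' (chB_ex G S) (Or.inl rfl)

lemma chF_pos (S : Finset (Fin d)) : 1 ≤ chF G S := by
  by_contra h
  have h0 : chF G S = 0 := by omega
  have := chF_spec G S
  rw [h0] at this
  rcases this with h | h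
  · omega
  · apply h
    simp [chV_zero, none_not_mem_XSet, chC]

lemma ch_sim_of_eq (hskel : ∀ a b, SkelAdj G a b ↔ chainAdj d a b) (S T : Finset (Fin d))
    (h : chF G S = chF G T) : SimG G S T := by
  have key : ∀ k, k ≤ chF G S → (chV d k ∈ XSet S ↔ chV d k ∈ XSet T) := by
    intro k hk
    rcases hk.lt_or_eq with hk | hk
    · have h1 := (chF_min G S hk).2
      have h2 := (chF_min G T (h ▸ hk)).2
      tauto
    · have h1 := chF_spec G S
      have h2 := chF_spec G T
      rw [← h, ← hk] at h2
      rw [← hk] at h1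
      by_cases hd : k = d + 1
      · rw [chV_big (by omega)]; simp [none_not_mem_XSet]
      · unfold chB at h1 h2; tauto
  refine ⟨S.filter (fun i : Fin d => d - (i : ℕ) ≤ chF G S), ?_, ?_⟩
  · intro i hi
    rw [Finset.mem_filter] at hi
    have := key _ hi.2
    rw [chV_sub, mem_XSet_some, mem_XSet_some] at this
    rw [Finset.mem_inter]; tauto
  · rintro p u v ⟨hp, hh, hl⟩ hu ⟨j, hj, rfl⟩
    rw [Set.mem_singleton_iff] at hu
    subst hu
    have hg := ch_path_get G hskel hp hh
    have hlen := hp.1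
    have hlast := (hg (p.length - 1) (by omega))
    have hjl : p.length - 1 = d - j := by
      have hj2 := j.2
      refine chV_inj hlast.1 (by omega) ?_
      rw [← hlast.2, chV_sub]
      rw [List.getLast?_eq_getElem?, List.getElem?_eq_getElem (by omega)] at hl
      simpa using hl
    have hjgt : chF G S < d - j := by
      by_contra hcon
      have := key (d - j) (by omega)
      rw [chV_sub, mem_XSet_some, mem_XSet_some] at this
      simp only [Finset.mem_sdiff, Finset.mem_union, Finset.mem_filter] at hj
      have h3 : d - (j : ℕ) ≤ chF G S := by omega
      tauto
    have hlt : chF G S < p.length := by omega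
    have hF1 := chF_pos G S
    have hmem : chV d (chF G S) ∈ XSet (S.filter (fun i : Fin d => d - (i : ℕ) ≤ chF G S)) ↔
        chV d (chF G S) ∈ XSet S := by
      rw [chV_pos hF1 (by omega), mem_XSet_some, mem_XSet_some, Finset.mem_filter]
      have : d - (d - chF G S) ≤ chF G S := by omega
      simp [this]
    have hsp := chF_spec G S
    have hsp' : ¬ (chV d (chF G S) ∈ XSet S ↔ chC G.edge (chF G S)) := by
      rcases hsp with h | h
      · omega
      · exact h
    by_cases hc : chC G.edge (chF G S)
    · right
      refine ⟨chF G S, hlt, (ch_collider_iff G hg _).2 ⟨by omega, hc⟩, ?_, ?_⟩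
      · rw [(hg _ _).2, hmem]; tauto
      · intro w hw
        rw [(hg _ _).2] at hw
        exact (ch_no_desc G hskel hc w hw).elim
    · left
      refine ⟨chF G S, hlt, ?_, ?_⟩
      · rw [ch_collider_iff G hg]; tauto
      · rw [(hg _ _).2, hmem]; tauto

lemma ch_not_sim_of_lt (hskel : ∀ a b, SkelAdj G a b ↔ chainAdj d a b) (S T : Finset (Fin d))
    (h : chF G S < chF G T) (C : Finset (Fin d)) (hCS : C ⊆ S) (hCT : C ⊆ T)
    (hsep : DSep G.edge {none} (XSet ((S ∪ T) \ C)) (XSet C)) : False := by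
  classical
  have hX : ∀ (A : Finset (Fin d)) (hA : C ⊆ A) (k : ℕ), chV d k ∈ XSet C → chV d k ∈ XSet A := by
    rintro A hA k ⟨i, hi, h⟩
    exact ⟨i, hA hi, h⟩
  have hU : ∀ k, chV d k ∈ XSet ((S ∪ T) \ C) ↔
      (chV d k ∈ XSet S ∨ chV d k ∈ XSet T) ∧ chV d k ∉ XSet C := by
    intro k
    cases chV d k with
    | none => simp [none_not_mem_XSet]
    | some i => simp [mem_XSet_some]
  have hle := chF_le G T
  have hgS := chF_spec G S
  have hgT := (chF_min G T h).2
  have hex : ∃ k, chV d k ∈ XSet ((S ∪ T) \ C) := by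
    refine ⟨chF G S, ?_⟩
    rw [hU]
    have h1 := hX S hCS (chF G S)
    have h2 := hX T hCT (chF G S)
    rcases hgS with h | h
    · omega
    · tauto
  have haS : Nat.find hex ≤ chF G S := by
    apply Nat.find_min'
    rw [hU]
    have h1 := hX S hCS (chF G S)
    have h2 := hX T hCT (chF G S)
    rcases hgS with h | h
    · omega
    · tauto
  have ha := Nat.find_spec hex
  have hmin := fun k (hk : k < Nat.find hex) => Nat.find_min hex hk
  generalize Nat.find hex = a at haS ha hmin
  have ha1 : 1 ≤ a := by
    by_contra h0
    have : a = 0 := by omega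
    subst this
    rw [chV_zero] at ha
    exact none_not_mem_XSet _ ha
  have had : a ≤ d := by omega
  have hg := chP_get (d := d) had
  have hlen : (chP d a).length = a + 1 := by simp [chP]
  have hb : ∀ b, b < a → (chV d b ∈ XSet C ↔ chC G.edge b) := by
    intro b hb
    have h1 := hmin b hb
    rw [hU] at h1
    have h2 := (chF_min G S (lt_of_lt_of_le hb haS)).2
    have h3 := hX S hCS b
    tauto
  rcases hsep (chP d a) none (chV d a) (chP_path G hskel ha1 had) rfl ha with
    ⟨i, hi, h1, h2⟩ | ⟨i, hi, h1, h2, -⟩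
  · rw [ch_collider_iff G hg] at h1
    rw [(hg _ _).2] at h2
    rcases Nat.lt_or_ge i a with hia | hia
    · exact h1 ⟨by omega, (hb i hia).1 h2⟩
    · have : i = a := by omega
      subst this
      exact ((hU _).1 ha).2 h2
  · rw [ch_collider_iff G hg] at h1
    rw [(hg _ _).2] at h2
    exact h2 ((hb i (by omega)).2 h1.2)

lemma ch_eq_of_sim (hskel : ∀ a b, SkelAdj G a b ↔ chainAdj d a b) (S T : Finset (Fin d))
    (h : SimG G S T) : chF G S = chF G T := by
  obtain ⟨C, hC, hsep⟩ := h
  have hCS : C ⊆ S := hC.trans Finset.inter_subset_left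
  have hCT : C ⊆ T := hC.trans Finset.inter_subset_right
  rcases lt_trichotomy (chF G S) (chF G T) with h | h | h
  · exact (ch_not_sim_of_lt G hskel S T h C hCS hCT hsep).elim
  · exact h
  · rw [Finset.union_comm] at hsep
    exact (ch_not_sim_of_lt G hskel T S h C hCT hCS hsep).elim

lemma chF_surj {k : ℕ} (h1 : 1 ≤ k) (hk : k ≤ d + 1) : ∃ S, chF G S = k := by
  classical
  let S : Finset (Fin d) := Finset.univ.filter (fun i =>
    (d - (i : ℕ) < k ∧ chC G.edge (d - i)) ∨ (d - (i : ℕ) = k ∧ ¬ chC G.edge k))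
  have hS : ∀ j, 1 ≤ j → j ≤ d → (chV d j ∈ XSet S ↔
      (j < k ∧ chC G.edge j) ∨ (j = k ∧ ¬ chC G.edge k)) := by
    intro j hj hjd
    rw [chV_pos hj hjd, mem_XSet_some]
    have : d - (d - j) = j := by omega
    simp [S, this]
  refine ⟨S, ?_⟩
  unfold chF
  rw [Nat.find_eq_iff]
  constructor
  · by_cases hkd : k = d + 1
    · exact Or.inl hkd
    · right
      rw [hS k h1 (by omega)]
      simp
  · intro n hn hB
    rcases hB with h | h
    · omega
    · apply h
      rcases Nat.eq_zero_or_pos n with rfl | hn0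
      · simp [chV_zero, none_not_mem_XSet, chC]
      · rw [hS n hn0 (by omega)]
        have : n ≠ k := by omega
        simp [hn, this]

end

/-- Let `d ≥ 1` and let `G` be any DAG on `Y, X_d, …, X_1` whose
skeleton is the path `Y − X_d − ⋯ − X_1`. Then `N_G = d + 1`. -/
theorem NG_chain {d : ℕ} (hd : 1 ≤ d) (G : DAG (Option (Fin d)))
    (hskel : ∀ a b, SkelAdj G a b ↔ chainAdj d a b) :
    NG G = d + 1 := by
  have hb : Function.Bijective (Quot.lift (fun S => (⟨chF G S - 1, by
      have := chF_le G S; omega⟩ : Fin (d + 1)))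
      (fun S T h => by simp only [ch_eq_of_sim G hskel S T h]) : Quot (SimG G) → Fin (d + 1)) := by
    constructor
    · intro x y
      induction x using Quot.ind with | _ S => ?_
      induction y using Quot.ind with | _ T => ?_
      intro h
      have h' : chF G S - 1 = chF G T - 1 := congrArg Fin.val h
      have h1 := chF_pos G S
      have h2 := chF_pos G T
      exact Quot.sound (ch_sim_of_eq G hskel S T (by omega))
    · intro n
      obtain ⟨S, hS⟩ := chF_surj G (k := n + 1) (by omega) (by omega)
      refine ⟨Quot.mk _ S, ?_⟩
      apply Fin.ext
      change chF G S - 1 = n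
      omega
  unfold NG
  rw [Nat.card_eq_of_bijective _ hb, Nat.card_eq_fintype_card, Fintype.card_fin]
end

section
/- Let d ≥ 2 and let G be any DAG on vertices Y, X_d, …, X_1 whose skeleton is the cycle Y − X_d − X_{d−1} − ⋯ − X_1 − Y (that is, G is an acyclic orientation of this cycle graph). Then N_G = (d² + d + 2)/2. -/
/-- Adjacency of the cycle skeleton `Y − X_d − X_{d−1} − ⋯ − X_1 − Y`, where the
covariate `X_j` is represented by the index `j - 1 : Fin d` and `Y` by `none`. -/
def cycleAdj (d : ℕ) : Option (Fin d) → Option (Fin d) → Prop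
  | some i, some j => (i : ℕ) + 1 = (j : ℕ) ∨ (j : ℕ) + 1 = (i : ℕ)
  | none, some i => (i : ℕ) = d - 1 ∨ (i : ℕ) = 0
  | some i, none => (i : ℕ) = d - 1 ∨ (i : ℕ) = 0
  | none, none => False

section Aux
open Classical

variable {d : ℕ}

theorem aux_nb {i : Fin d} {x y z : Option (Fin d)} (hxy : x ≠ y)
    (hx : cycleAdj d x (some i)) (hy : cycleAdj d y (some i)) (hz : cycleAdj d z (some i)) :
    z = x ∨ z = y := by
  have hi := i.2
  rcases x with _ | x <;> rcases y with _ | y <;> rcases z with _ | z <;>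
    simp only [cycleAdj, ne_eq, not_true_eq_false, reduceCtorEq, not_false_eq_true, Option.some.injEq,
      Fin.ext_iff, or_false, false_or, or_true] at * <;> omega

/-- covariates without outgoing edges -/
noncomputable def sinks (G : DAG (Option (Fin d))) : Finset (Fin d) :=
  Finset.univ.filter fun i => ∀ x, ¬ G.edge (some i) x

theorem mem_sinks (G : DAG (Option (Fin d))) (i : Fin d) :
    i ∈ sinks G ↔ ∀ x, ¬ G.edge (some i) x := by simp [sinks]

theorem aux_asymm (G : DAG (Option (Fin d))) {a b : Option (Fin d)} (h : G.edge a b) :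
    ¬ G.edge b a := fun h' =>
  G.acyclic a ((Relation.TransGen.single h).tail h')

theorem collider_sink (G : DAG (Option (Fin d)))
    (hskel : ∀ a b, SkelAdj G a b ↔ cycleAdj d a b) {p : List (Option (Fin d))}
    (hp : IsPath G.edge p) {i : ℕ} (hi : i < p.length) {w : Fin d} (hw : p[i] = some w)
    (hc : IsColliderAt G.edge p i) : w ∈ sinks G := by
  obtain ⟨h1, h2, e1, e2⟩ := hc
  simp only [List.get_eq_getElem, hw] at e1 e2
  rw [mem_sinks]
  intro x hx
  have hne : p[i-1] ≠ p[i+1] := by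
    intro h
    have := (List.Nodup.getElem_inj_iff hp.2.1).1 h
    omega
  rcases aux_nb hne ((hskel _ _).1 (Or.inl e1)) ((hskel _ _).1 (Or.inl e2))
    ((hskel _ _).1 (Or.inr hx)) with rfl | rfl
  · exact aux_asymm G e1 hx
  · exact aux_asymm G e2 hx

theorem sink_collider (G : DAG (Option (Fin d))) {p : List (Option (Fin d))}
    (hp : IsPath G.edge p) {i : ℕ} (h1 : 1 ≤ i) (hi : i + 1 < p.length) {w : Fin d}
    (hw : p[i] = some w) (hs : w ∈ sinks G) : IsColliderAt G.edge p i := by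
  rw [mem_sinks] at hs
  refine ⟨h1, hi, ?_, ?_⟩
  · have := hp.2.2 (i-1) (by omega)
    simp only [List.get_eq_getElem, Nat.sub_add_cancel h1, hw] at this ⊢
    exact this.resolve_right (hs _)
  · have := hp.2.2 i hi
    simp only [List.get_eq_getElem, hw] at this ⊢
    exact this.resolve_left (hs _)

theorem blocked_iff (G : DAG (Option (Fin d)))
    (hskel : ∀ a b, SkelAdj G a b ↔ cycleAdj d a b) {p : List (Option (Fin d))} {v : Fin d}
    (hp : PathBetween G.edge p none (some v)) {T : Finset (Fin d)} (hv : v ∉ T) :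
    Blocked G.edge (XSet T) p ↔ ∃ w ∈ symmDiff T (sinks G), some w ∈ p ∧ w ≠ v := by
  obtain ⟨hp, h0, hl⟩ := hp
  have hlen := hp.1
  have h0' : p[0] = none := by
    rw [List.head?_eq_getElem?, List.getElem?_eq_getElem (by omega)] at h0
    simpa using h0
  have hl' : p[p.length - 1] = some v := by
    rw [List.getLast?_eq_getElem?, List.getElem?_eq_getElem (by omega)] at hl
    simpa using hl
  constructor
  · rintro (⟨i, hi, hc, w, hw, hwi⟩ | ⟨i, hi, hc, hn, -⟩)
    · simp only [List.get_eq_getElem] at hwi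
      have hwv : w ≠ v := by rintro rfl; exact hv hw
      refine ⟨w, ?_, hwi ▸ List.getElem_mem hi, hwv⟩
      rw [Finset.mem_symmDiff]
      refine Or.inl ⟨hw, fun hs => hc (sink_collider G hp ?_ ?_ hwi hs)⟩
      · rcases Nat.eq_zero_or_pos i with rfl | h
        · simp [h0'] at hwi
        · exact h
      · by_contra h
        have : i = p.length - 1 := by omega
        subst this
        rw [hl'] at hwi
        exact hwv (Option.some.inj hwi).symm
    · have hc' := hc
      obtain ⟨h1, h2, -, -⟩ := hc
      simp only [List.get_eq_getElem] at hn
      cases hwi : p[i] with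
      | none =>
        have := (List.Nodup.getElem_inj_iff hp.2.1).1 (hwi.trans h0'.symm)
        omega
      | some w =>
        refine ⟨w, ?_, hwi ▸ List.getElem_mem hi, ?_⟩
        · rw [Finset.mem_symmDiff]
          refine Or.inr ⟨collider_sink G hskel hp hi hwi hc', fun h => hn ⟨w, h, hwi⟩⟩
        · rintro rfl
          have := (List.Nodup.getElem_inj_iff hp.2.1).1 (hwi.trans hl'.symm)
          omega
  · rintro ⟨w, hw, hwp, hwv⟩
    obtain ⟨i, hi, hwi⟩ := List.getElem_of_mem hwp
    have hi1 : 1 ≤ i := by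
      rcases Nat.eq_zero_or_pos i with rfl | h
      · simp [h0'] at hwi
      · exact h
    have hi2 : i + 1 < p.length := by
      by_contra h
      have : i = p.length - 1 := by omega
      subst this
      rw [hl'] at hwi
      exact hwv (Option.some.inj hwi).symm
    rw [Finset.mem_symmDiff] at hw
    rcases hw with ⟨hT, hs⟩ | ⟨hs, hT⟩
    · exact Or.inl ⟨i, hi, fun hc => hs (collider_sink G hskel hp hi hwi hc), w, hT, hwi⟩
    · refine Or.inr ⟨i, hi, sink_collider G hp hi1 hi2 hwi hs, ?_, ?_⟩
      · rintro ⟨w', hw', h⟩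
        simp only [List.get_eq_getElem, hwi, Option.some.injEq] at h
        exact hT (h ▸ hw')
      · intro x hx
        simp only [List.get_eq_getElem, hwi] at hx
        rw [mem_sinks] at hs
        obtain ⟨y, hy, -⟩ := Relation.TransGen.head'_iff.1 hx
        exact absurd hy (hs y)

/-- every path from the target to `v` goes through everything below or everything above `v`. -/
theorem path_covers (G : DAG (Option (Fin d)))
    (hskel : ∀ a b, SkelAdj G a b ↔ cycleAdj d a b) {p : List (Option (Fin d))} {v a b : Fin d}
    (hp : PathBetween G.edge p none (some v)) (hav : a < v) (hvb : v < b) :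
    some a ∈ p ∨ some b ∈ p := by
  obtain ⟨hp, h0, hl⟩ := hp
  have hlen := hp.1
  have h0' : p[0] = none := by
    rw [List.head?_eq_getElem?, List.getElem?_eq_getElem (by omega)] at h0
    simpa using h0
  have hl' : p[p.length - 1] = some v := by
    rw [List.getLast?_eq_getElem?, List.getElem?_eq_getElem (by omega)] at hl
    simpa using hl
  by_contra hcon
  push Not at hcon
  obtain ⟨ha, hb⟩ := hcon
  have key : ∀ i (hi : i + 1 < p.length), ∃ w, p[i+1] = some w ∧ (w < a ∨ b < w) := by
    intro i
    induction i with
    | zero =>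
      intro hi
      have hadj := (hskel _ _).1 (hp.2.2 0 hi)
      simp only [List.get_eq_getElem, h0'] at hadj
      cases hwi : p[0+1] with
      | none => rw [hwi] at hadj; exact hadj.elim
      | some w =>
        rw [hwi] at hadj
        refine ⟨w, rfl, ?_⟩
        have hwa : w ≠ a := by rintro rfl; exact ha (hwi ▸ List.getElem_mem hi)
        have hwb : w ≠ b := by rintro rfl; exact hb (hwi ▸ List.getElem_mem hi)
        simp only [cycleAdj] at hadj
        omega
    | succ i ih =>
      intro hi
      obtain ⟨u, hu, hu'⟩ := ih (by omega)
      have hadj := (hskel _ _).1 (hp.2.2 (i+1) hi)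
      simp only [List.get_eq_getElem, hu] at hadj
      cases hwi : p[i+1+1] with
      | none =>
        have := (List.Nodup.getElem_inj_iff hp.2.1).1 (hwi.trans h0'.symm)
        omega
      | some w =>
        rw [hwi] at hadj
        refine ⟨w, rfl, ?_⟩
        have hwa : w ≠ a := by rintro rfl; exact ha (hwi ▸ List.getElem_mem hi)
        have hwb : w ≠ b := by rintro rfl; exact hb (hwi ▸ List.getElem_mem hi)
        simp only [cycleAdj] at hadj
        omega
  obtain ⟨w, hw, hw'⟩ := key (p.length - 2) (by omega)
  have h2 : p.length - 2 + 1 = p.length - 1 := by omega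
  simp only [h2, hl', Option.some.injEq] at hw
  subst hw
  omega

theorem path_up (hd : 2 ≤ d) (G : DAG (Option (Fin d)))
    (hskel : ∀ a b, SkelAdj G a b ↔ cycleAdj d a b) (v : Fin d) :
    ∃ p, PathBetween G.edge p none (some v) ∧ ∀ w, some w ∈ p → w ≤ v := by
  have hv := v.2
  refine ⟨List.ofFn (n := v + 2) fun i =>
    if h : (i : ℕ) = 0 then none else some ⟨i - 1, by omega⟩, ⟨⟨?_, ?_, ?_⟩, ?_, ?_⟩, ?_⟩
  · simp
  · rw [List.nodup_ofFn]
    intro i j h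
    ext
    dsimp only at h
    split_ifs at h with h1 h2 h2
    · omega
    · simp only [Option.some.injEq, Fin.mk.injEq] at h; omega
  · intro i h
    refine (hskel _ _).2 ?_
    simp only [List.length_ofFn] at h
    simp only [List.get_eq_getElem, List.getElem_ofFn]
    rcases Nat.eq_zero_or_pos i with rfl | hi
    · simp [cycleAdj]
    · have : i ≠ 0 := by omega
      simp only [this, dite_false, Nat.add_eq_zero_iff, one_ne_zero, and_false, cycleAdj]
      omega
  · simp [List.head?_eq_getElem?]
  · simp [List.getLast?_eq_getElem?, -List.ofFn_succ]
  · intro w hw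
    rw [List.mem_ofFn] at hw
    obtain ⟨i, hi⟩ := hw
    split_ifs at hi with h
    simp only [Option.some.injEq] at hi
    subst hi
    have := i.2
    rw [Fin.le_def]
    dsimp only
    omega

theorem path_down (hd : 2 ≤ d) (G : DAG (Option (Fin d)))
    (hskel : ∀ a b, SkelAdj G a b ↔ cycleAdj d a b) (v : Fin d) :
    ∃ p, PathBetween G.edge p none (some v) ∧ ∀ w, some w ∈ p → v ≤ w := by
  have hv := v.2
  refine ⟨List.ofFn (n := d - v + 1) fun i =>
    if h : (i : ℕ) = 0 then none else some ⟨d - i, by omega⟩, ⟨⟨?_, ?_, ?_⟩, ?_, ?_⟩, ?_⟩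
  · simp; omega
  · rw [List.nodup_ofFn]
    intro i j h
    ext
    dsimp only at h
    split_ifs at h with h1 h2 h2
    · omega
    · simp only [Option.some.injEq, Fin.mk.injEq] at h; omega
  · intro i h
    refine (hskel _ _).2 ?_
    simp only [List.length_ofFn] at h
    simp only [List.get_eq_getElem, List.getElem_ofFn]
    rcases Nat.eq_zero_or_pos i with rfl | hi
    · simp [cycleAdj]
    · have : i ≠ 0 := by omega
      simp only [this, dite_false, Nat.add_eq_zero_iff, one_ne_zero, and_false, cycleAdj]
      omega
  · simp [List.head?_eq_getElem?]
  · have h1 : d - (v : ℕ) ≠ 0 := by omega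
    have h2 : d - (d - (v : ℕ)) = v := by omega
    simp [List.getLast?_eq_getElem?, -List.ofFn_succ, h1, h2]
  · intro w hw
    rw [List.mem_ofFn] at hw
    obtain ⟨i, hi⟩ := hw
    split_ifs at hi with h
    simp only [Option.some.injEq] at hi
    subst hi
    have := i.2
    rw [Fin.le_def]
    dsimp only
    omega

theorem dsep_iff (hd : 2 ≤ d) (G : DAG (Option (Fin d)))
    (hskel : ∀ a b, SkelAdj G a b ↔ cycleAdj d a b) (B T : Finset (Fin d)) :
    DSep G.edge {none} (XSet (B \ T)) (XSet T) ↔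
      ∀ v ∈ B \ T, ∃ a ∈ symmDiff T (sinks G), ∃ b ∈ symmDiff T (sinks G), a < v ∧ v < b := by
  constructor
  · intro h v hv
    have hvT := (Finset.mem_sdiff.1 hv).2
    obtain ⟨p, hp, hpw⟩ := path_up hd G hskel v
    obtain ⟨q, hq, hqw⟩ := path_down hd G hskel v
    obtain ⟨a, ha, hap, hav⟩ := (blocked_iff G hskel hp hvT).1 (h p _ _ hp rfl ⟨v, hv, rfl⟩)
    obtain ⟨b, hb, hbp, hbv⟩ := (blocked_iff G hskel hq hvT).1 (h q _ _ hq rfl ⟨v, hv, rfl⟩)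
    exact ⟨a, ha, b, hb, lt_of_le_of_ne (hpw _ hap) hav, lt_of_le_of_ne (hqw _ hbp) hbv.symm⟩
  · rintro h p u _ hp rfl ⟨v, hv, rfl⟩
    have hvT := (Finset.mem_sdiff.1 hv).2
    obtain ⟨a, ha, b, hb, hav, hvb⟩ := h v hv
    rw [blocked_iff G hskel hp hvT]
    rcases path_covers G hskel hp hav hvb with h | h
    · exact ⟨a, ha, h, hav.ne⟩
    · exact ⟨b, hb, h, hvb.ne'⟩

/-- the unordered pair formed by the minimum and the maximum -/
noncomputable def ends (D : Finset (Fin d)) : Option (Sym2 (Fin d)) :=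
  if h : D.Nonempty then some s(D.min' h, D.max' h) else none

theorem ends_eq {D E : Finset (Fin d)} (hD : D.Nonempty) (hE : E.Nonempty) :
    ends D = ends E ↔ D.min' hD = E.min' hE ∧ D.max' hD = E.max' hE := by
  simp only [ends, hD, hE, dite_true, Option.some.injEq, Sym2.eq_iff]
  have h1 := D.min'_le_max' hD
  have h2 := E.min'_le_max' hE
  constructor
  · rintro (h | ⟨h, h'⟩)
    · exact h
    · rw [h, h'] at h1
      have := le_antisymm h1 h2
      exact ⟨h.trans this, h'.trans this.symm⟩
  · exact Or.inl

theorem ends_of_agree {S T C : Finset (Fin d)} (hTS : T ⊆ S)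
    (h : ∀ v ∈ S \ T, ∃ a ∈ symmDiff T C, ∃ b ∈ symmDiff T C, a < v ∧ v < b) :
    ends (symmDiff S C) = ends (symmDiff T C) := by
  by_cases hne : (symmDiff T C).Nonempty
  · have hmem : ∀ x, x ∉ S \ T → (x ∈ symmDiff S C ↔ x ∈ symmDiff T C) := by
      intro x hx
      have : x ∈ S ↔ x ∈ T := ⟨fun h => by_contra fun h' => hx (Finset.mem_sdiff.2 ⟨h, h'⟩),
        fun h => hTS h⟩
      simp only [Finset.mem_symmDiff, this]
    have hmin : ∀ v ∈ S \ T, (symmDiff T C).min' hne < v ∧ v < (symmDiff T C).max' hne := by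
      intro v hv
      obtain ⟨a, ha, b, hb, h1, h2⟩ := h v hv
      exact ⟨(Finset.min'_le _ _ ha).trans_lt h1, h2.trans_le (Finset.le_max' _ _ hb)⟩
    have m1 : (symmDiff T C).min' hne ∈ symmDiff S C :=
      (hmem _ fun hx => (hmin _ hx).1.ne rfl).2 (Finset.min'_mem _ _)
    have m2 : (symmDiff T C).max' hne ∈ symmDiff S C :=
      (hmem _ fun hx => (hmin _ hx).2.ne rfl).2 (Finset.max'_mem _ _)
    rw [ends_eq ⟨_, m1⟩ hne]
    constructor
    · refine le_antisymm (Finset.min'_le _ _ m1) (Finset.le_min' _ _ _ fun y hy => ?_)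
      by_cases hyS : y ∈ S \ T
      · exact (hmin y hyS).1.le
      · exact Finset.min'_le _ _ ((hmem y hyS).1 hy)
    · refine le_antisymm (Finset.max'_le _ _ _ fun y hy => ?_) (Finset.le_max' _ _ m2)
      by_cases hyS : y ∈ S \ T
      · exact (hmin y hyS).2.le
      · exact Finset.le_max' _ _ ((hmem y hyS).1 hy)
  · have : S = T := by
      refine (hTS.antisymm fun x hx => ?_).symm
      by_contra hx'
      obtain ⟨a, ha, -⟩ := h x (Finset.mem_sdiff.2 ⟨hx, hx'⟩)
      exact hne ⟨a, ha⟩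
    rw [this]

theorem simG_iff (hd : 2 ≤ d) (G : DAG (Option (Fin d)))
    (hskel : ∀ a b, SkelAdj G a b ↔ cycleAdj d a b) (S S' : Finset (Fin d)) :
    SimG G S S' ↔ ends (symmDiff S (sinks G)) = ends (symmDiff S' (sinks G)) := by
  constructor
  · rintro ⟨T, hT, h⟩
    have h' := (dsep_iff hd G hskel (S ∪ S') T).1 (by convert h)
    have hT1 : T ⊆ S := hT.trans Finset.inter_subset_left
    have hT2 : T ⊆ S' := hT.trans Finset.inter_subset_right
    rw [ends_of_agree hT1, ends_of_agree hT2]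
    · intro v hv
      exact h' v (Finset.sdiff_subset_sdiff Finset.subset_union_right subset_rfl hv)
    · intro v hv
      exact h' v (Finset.sdiff_subset_sdiff Finset.subset_union_left subset_rfl hv)
  · intro h
    refine ⟨S ∩ S', by intro x hx; simpa using hx, ?_⟩
    have := (dsep_iff hd G hskel (S ∪ S') (S ∩ S')).2 ?_
    · convert this
    set C := sinks G
    have hmemT : ∀ x, x ∈ symmDiff S C → x ∈ symmDiff S' C → x ∈ symmDiff (S ∩ S') C := by
      intro x
      simp only [Finset.mem_symmDiff, Finset.mem_inter]
      tauto
    intro v hv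
    have hv' : (v ∈ symmDiff S C ∧ v ∉ symmDiff S' C) ∨
        (v ∈ symmDiff S' C ∧ v ∉ symmDiff S C) := by
      simp only [Finset.mem_sdiff, Finset.mem_union, Finset.mem_inter] at hv
      simp only [Finset.mem_symmDiff]
      tauto
    have hne : (symmDiff S C).Nonempty ∧ (symmDiff S' C).Nonempty := by
      by_cases h1 : (symmDiff S C).Nonempty <;> by_cases h2 : (symmDiff S' C).Nonempty
      · exact ⟨h1, h2⟩
      · simp [ends, h1, h2] at h
      · simp [ends, h1, h2] at h
      · rcases hv' with hv' | hv'
        · exact (h1 ⟨v, hv'.1⟩).elim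
        · exact (h2 ⟨v, hv'.1⟩).elim
    obtain ⟨n1, n2⟩ := hne
    obtain ⟨e1, e2⟩ := (ends_eq n1 n2).1 h
    have a1 := Finset.min'_mem _ n1
    have a2 := Finset.min'_mem _ n2
    have b1 := Finset.max'_mem _ n1
    have b2 := Finset.max'_mem _ n2
    refine ⟨_, hmemT _ a1 (e1 ▸ a2), _, hmemT _ b1 (e2 ▸ b2), ?_, ?_⟩
    · rcases hv' with ⟨hv1, hv2⟩ | ⟨hv1, hv2⟩
      · refine lt_of_le_of_ne (Finset.min'_le _ _ hv1) ?_
        rintro rfl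
        exact hv2 (e1 ▸ a2)
      · rw [e1]
        refine lt_of_le_of_ne (Finset.min'_le _ _ hv1) ?_
        rintro rfl
        exact hv2 (e1 ▸ a1)
    · rcases hv' with ⟨hv1, hv2⟩ | ⟨hv1, hv2⟩
      · refine lt_of_le_of_ne (Finset.le_max' _ _ hv1) ?_
        rintro rfl
        exact hv2 (e2 ▸ b2)
      · rw [e2]
        refine lt_of_le_of_ne (Finset.le_max' _ _ hv1) ?_
        rintro rfl
        exact hv2 (e2 ▸ b1)

theorem ends_surj : Function.Surjective (ends : Finset (Fin d) → Option (Sym2 (Fin d))) := by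
  intro x
  cases x with
  | none => exact ⟨∅, by simp [ends]⟩
  | some z =>
    induction z using Sym2.ind with
    | _ a b =>
      wlog hab : a ≤ b generalizing a b
      · rw [Sym2.eq_swap]
        exact this b a (le_of_not_ge hab)
      refine ⟨{a, b}, ?_⟩
      have hne : ({a, b} : Finset (Fin d)).Nonempty := ⟨a, by simp⟩
      have h1 : ({a, b} : Finset (Fin d)).min' hne = a :=
        le_antisymm (Finset.min'_le _ _ (by simp))
          (Finset.le_min' _ _ _ (by simp [hab]))
      have h2 : ({a, b} : Finset (Fin d)).max' hne = b :=
        le_antisymm (Finset.max'_le _ _ _ (by simp [hab]))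
          (Finset.le_max' _ _ (by simp))
      simp only [ends, hne, dite_true, h1, h2]

end Aux

/-- Let `d ≥ 2` and let `G` be any DAG on `Y, X_d, …, X_1` whose
skeleton is the cycle `Y − X_d − ⋯ − X_1 − Y`. Then `N_G = (d² + d + 2)/2`. -/
theorem NG_cycle {d : ℕ} (hd : 2 ≤ d) (G : DAG (Option (Fin d)))
    (hskel : ∀ a b, SkelAdj G a b ↔ cycleAdj d a b) :
    2 * NG G = d ^ 2 + d + 2 := by
  classical
  let f : Quot (SimG G) → Option (Sym2 (Fin d)) :=
    Quot.lift (fun S => ends (symmDiff S (sinks G)))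
      (fun S S' h => by
        have := (simG_iff hd G hskel S S').1 h
        convert this)
  have hf : Function.Bijective f := by
    constructor
    · rintro ⟨S⟩ ⟨S'⟩ h
      refine Quot.sound ((simG_iff hd G hskel S S').2 ?_)
      convert (show ends (symmDiff S (sinks G)) = ends (symmDiff S' (sinks G)) from h)
    · intro x
      obtain ⟨D, rfl⟩ := ends_surj x
      refine ⟨Quot.mk _ (symmDiff D (sinks G)), ?_⟩
      change ends (symmDiff (symmDiff D (sinks G)) (sinks G)) = _
      rw [symmDiff_symmDiff_cancel_right]
  have hcard : NG G = Nat.choose (d + 1) 2 + 1 := by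
    unfold NG
    rw [Nat.card_congr (Equiv.ofBijective f hf), Nat.card_eq_fintype_card, Fintype.card_option,
      Sym2.card, Fintype.card_fin]
  have hch : Nat.choose (d + 1) 2 * 2 = (d + 1) * d := by
    have := Nat.triangle_succ d
    rw [Nat.choose_two_right]
    exact Nat.div_mul_cancel (by simpa [mul_comm] using (Nat.even_mul_succ_self d).two_dvd)
  rw [hcard]
  nlinarith
end

section
/- There exists a constant c > 0 such that every finite connected simple graph G with d ≥ 2 vertices in which every vertex has degree 1 or degree at least 3 has a spanning tree with at least c·d leaves. -/
open Classical in
/-- closed neighbourhood of `I` -/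
noncomputable def clN {V : Type} [Fintype V] (G : SimpleGraph V) (I : Finset V) : Finset V :=
  Finset.univ.filter (fun v => v ∈ I ∨ ∃ u ∈ I, G.Adj u v)

open Classical in
/-- outside neighbours of `p` -/
noncomputable def outN {V : Type} [Fintype V] (G : SimpleGraph V) (I : Finset V) (p : V) :
    Finset V :=
  Finset.univ.filter (fun v => G.Adj p v ∧ v ∉ clN G I)

open Classical in
/-- the leaves -/
noncomputable def lfN {V : Type} [Fintype V] (G : SimpleGraph V) (I : Finset V) : Finset V :=
  Finset.univ.filter (fun v => v ∈ clN G I ∧ v ∉ I)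

open Classical in
/-- the dead leaves -/
noncomputable def ddN {V : Type} [Fintype V] (G : SimpleGraph V) (I : Finset V) : Finset V :=
  Finset.univ.filter (fun v => v ∈ lfN G I ∧ ∀ w, G.Adj v w → w ∈ clN G I)

/-- the edges of `G` inside `I` -/
def inG {V : Type} (G : SimpleGraph V) (I : Finset V) : SimpleGraph V where
  Adj a b := G.Adj a b ∧ a ∈ I ∧ b ∈ I
  symm := ⟨fun _ _ h => ⟨h.1.symm, h.2.2, h.2.1⟩⟩
  loopless := ⟨fun a h => G.loopless.irrefl a h.1⟩

/-- `I` is nonempty and connected in `G` -/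
def cnN {V : Type} (G : SimpleGraph V) (I : Finset V) : Prop :=
  ∃ r ∈ I, ∀ a ∈ I, (inG G I).Reachable a r

theorem mem_clN {V : Type} [Fintype V] {G : SimpleGraph V} {I : Finset V} {v : V} :
    v ∈ clN G I ↔ v ∈ I ∨ ∃ u ∈ I, G.Adj u v := by simp [clN]

theorem mem_outN {V : Type} [Fintype V] {G : SimpleGraph V} {I : Finset V} {p v : V} :
    v ∈ outN G I p ↔ G.Adj p v ∧ v ∉ clN G I := by simp [outN]

theorem mem_lfN {V : Type} [Fintype V] {G : SimpleGraph V} {I : Finset V} {v : V} :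
    v ∈ lfN G I ↔ v ∈ clN G I ∧ v ∉ I := by simp [lfN]

theorem mem_ddN {V : Type} [Fintype V] {G : SimpleGraph V} {I : Finset V} {v : V} :
    v ∈ ddN G I ↔ v ∈ lfN G I ∧ ∀ w, G.Adj v w → w ∈ clN G I := by simp [ddN]

open Classical in
theorem clN_insert {V : Type} [Fintype V] {G : SimpleGraph V} {I : Finset V} {p : V}
    (hp : p ∈ lfN G I) : clN G (insert p I) = clN G I ∪ outN G I p := by
  ext v
  have h1 := (mem_lfN.1 hp).1
  simp only [Finset.mem_union, mem_outN]
  by_cases hv : v ∈ clN G I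
  · simp only [hv, true_or, iff_true]
    rw [mem_clN] at hv ⊢
    simp only [Finset.mem_insert]
    grind
  · simp only [hv, false_or, not_false_eq_true, and_true]
    have hv' := hv
    rw [mem_clN] at hv ⊢
    simp only [Finset.mem_insert]
    have : v ≠ p := by rintro rfl; exact hv' h1
    grind

open Classical in
theorem lfN_insert {V : Type} [Fintype V] {G : SimpleGraph V} {I : Finset V} {p : V}
    (hp : p ∈ lfN G I) : lfN G (insert p I) = (lfN G I).erase p ∪ outN G I p := by
  ext v
  have h1 := (mem_lfN.1 hp)
  simp only [mem_lfN, clN_insert hp, Finset.mem_union, Finset.mem_erase, Finset.mem_insert,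
    mem_outN]
  have : v ∈ I → v ∈ clN G I := fun h => mem_clN.2 (Or.inl h)
  have : v ∈ clN G I ∨ v ≠ p := by
    by_cases h : v = p
    · subst h; exact Or.inl h1.1
    · exact Or.inr h
  grind

open Classical in
theorem card_insert_facts {V : Type} [Fintype V] {G : SimpleGraph V} {I : Finset V} {p : V}
    (hp : p ∈ lfN G I) (ho : 1 ≤ (outN G I p).card) :
    (clN G (insert p I)).card = (clN G I).card + (outN G I p).card ∧
    (lfN G (insert p I)).card + 1 = (lfN G I).card + (outN G I p).card ∧
    ddN G I ⊆ ddN G (insert p I) := by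
  refine ⟨?_, ?_, ?_⟩
  · rw [clN_insert hp, Finset.card_union_of_disjoint]
    rw [Finset.disjoint_left]
    intro a ha h
    exact (mem_outN.1 h).2 ha
  · rw [lfN_insert hp, Finset.card_union_of_disjoint, Finset.card_erase_of_mem hp]
    · have := Finset.card_pos.2 ⟨p, hp⟩
      omega
    rw [Finset.disjoint_left]
    intro a ha h
    exact (mem_outN.1 h).2 (mem_lfN.1 (Finset.mem_of_mem_erase ha)).1
  · intro v hv
    rw [mem_ddN] at hv ⊢
    obtain ⟨x, hx⟩ := Finset.card_pos.1 ho
    rw [mem_outN] at hx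
    have hne : v ≠ p := by
      rintro rfl
      exact hx.2 (hv.2 _ hx.1)
    rw [lfN_insert hp, clN_insert hp]
    refine ⟨?_, fun w hw => Finset.mem_union_left _ (hv.2 w hw)⟩
    exact Finset.mem_union_left _ (Finset.mem_erase.2 ⟨hne, hv.1⟩)

theorem inG_mono {V : Type} (G : SimpleGraph V) {I J : Finset V} (h : I ⊆ J) :
    inG G I ≤ inG G J := fun _ _ hab => ⟨hab.1, h hab.2.1, h hab.2.2⟩

open Classical in
theorem cnN_insert {V : Type} [Fintype V] {G : SimpleGraph V} {I : Finset V} {p : V}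
    (hp : p ∈ lfN G I) (hI : cnN G I) : cnN G (insert p I) := by
  obtain ⟨r, hr, h⟩ := hI
  have hm := inG_mono G (Finset.subset_insert p I)
  refine ⟨r, Finset.mem_insert_of_mem hr, fun a ha => ?_⟩
  rcases Finset.mem_insert.1 ha with rfl | ha
  · obtain ⟨h1, h2⟩ := mem_lfN.1 hp
    rcases mem_clN.1 h1 with h3 | ⟨u, hu, hau⟩
    · exact absurd h3 h2
    · have hadj : (inG G (insert a I)).Adj a u := ⟨hau.symm, by simp, by simp [hu]⟩
      exact hadj.reachable.trans ((h u hu).mono hm)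
  · exact (h a ha).mono hm

open Classical in
theorem grow_step {V : Type} [Fintype V] {G : SimpleGraph V} (hG : G.Connected)
    (hdeg : ∀ v : V, (G.neighborSet v).ncard = 1 ∨ 3 ≤ (G.neighborSet v).ncard)
    {I : Finset V} (hI : cnN G I)
    (hinv : (clN G I).card ≤ 3 * ((lfN G I).card + (ddN G I).card))
    (hne : clN G I ≠ Finset.univ) :
    ∃ J : Finset V, cnN G J ∧ (clN G J).card ≤ 3 * ((lfN G J).card + (ddN G J).card) ∧
      I.card < J.card := by
  have hout : ∃ p ∈ lfN G I, 1 ≤ (outN G I p).card := by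
    obtain ⟨r, hr, -⟩ := hI
    obtain ⟨z, hz⟩ : ∃ z, z ∉ clN G I := by
      by_contra! h
      exact hne (Finset.eq_univ_iff_forall.2 h)
    obtain ⟨w⟩ := hG.preconnected r z
    obtain ⟨d, -, h1, h2⟩ := w.exists_boundary_dart (clN G I : Set V)
      (Finset.mem_coe.2 (mem_clN.2 (Or.inl hr))) (by simpa using hz)
    simp only [Finset.mem_coe] at h1 h2
    refine ⟨d.fst, mem_lfN.2 ⟨h1, fun h => h2 (mem_clN.2 (Or.inr ⟨_, h, d.adj⟩))⟩, ?_⟩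
    exact Finset.card_pos.2 ⟨d.snd, mem_outN.2 ⟨d.adj, h2⟩⟩
  by_cases hbig : ∃ p ∈ lfN G I, 2 ≤ (outN G I p).card
  · obtain ⟨p, hp, h2⟩ := hbig
    obtain ⟨a, b, c⟩ := card_insert_facts hp (by omega)
    have c := Finset.card_le_card c
    refine ⟨insert p I, cnN_insert hp hI, by omega, ?_⟩
    rw [Finset.card_insert_of_notMem (mem_lfN.1 hp).2]; omega
  push Not at hbig
  obtain ⟨p, hp, h1⟩ := hout
  have h1' : (outN G I p).card = 1 := by have := hbig p hp; omega
  obtain ⟨x, hx⟩ := Finset.card_eq_one.1 h1'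
  have hxo : x ∈ outN G I p := by simp [hx]
  obtain ⟨hpx, hxS⟩ := mem_outN.1 hxo
  obtain ⟨a, b, c⟩ := card_insert_facts hp h1
  have hcI := cnN_insert hp hI
  have hcard : (insert p I).card = I.card + 1 :=
    Finset.card_insert_of_notMem (mem_lfN.1 hp).2
  have hxl : x ∈ lfN G (insert p I) := by
    rw [lfN_insert hp]; exact Finset.mem_union_right _ hxo
  have hoe : outN G (insert p I) x = outN G I x := by
    ext v
    simp only [mem_outN, clN_insert hp, hx, Finset.mem_union, Finset.mem_singleton]
    have : G.Adj x v → v ≠ x := fun h => h.ne'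
    tauto
  by_cases hx2 : 2 ≤ (outN G I x).card
  · obtain ⟨a', b', c'⟩ := card_insert_facts hxl (by rw [hoe]; omega)
    have c := Finset.card_le_card c
    have c' := Finset.card_le_card c'
    rw [hoe] at a' b'
    refine ⟨insert x (insert p I), cnN_insert hxl hcI, by omega, ?_⟩
    rw [Finset.card_insert_of_notMem (mem_lfN.1 hxl).2]; omega
  refine ⟨insert p I, hcI, ?_, by omega⟩
  suffices h : ∃ q, q ∉ ddN G I ∧ q ∈ ddN G (insert p I) by
    obtain ⟨q, hq1, hq2⟩ := h
    have := Finset.card_lt_card (Finset.ssubset_iff_of_subset c |>.2 ⟨q, hq2, hq1⟩)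
    omega
  have hxx : x ∉ ddN G I := fun h => hxS (mem_lfN.1 (mem_ddN.1 h).1).1
  rcases hdeg x with hd | hd
  · refine ⟨x, hxx, mem_ddN.2 ⟨hxl, fun w hw => ?_⟩⟩
    obtain ⟨y, hy⟩ := Set.ncard_eq_one.1 hd
    have e1 : w ∈ G.neighborSet x := hw
    have e2 : p ∈ G.neighborSet x := hpx.symm
    rw [hy] at e1 e2
    have : w = p := by rw [e1, e2]
    rw [this, mem_clN]
    left; simp
  · obtain ⟨q, hq⟩ : ∃ q, q ∈ G.neighborSet x ∧ q ≠ p ∧ q ∉ outN G I x := by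
      by_contra! h
      have hsub : G.neighborSet x ⊆ ((insert p (outN G I x) : Finset V) : Set V) := by
        intro q hq
        by_cases e : q = p
        · simp [e]
        · simp [h q hq e]
      have := Set.ncard_le_ncard hsub (Finset.finite_toSet _)
      rw [Set.ncard_coe_finset] at this
      have := Finset.card_insert_le p (outN G I x)
      omega
    obtain ⟨hxq, hqp, hqo⟩ := hq
    have hxq : G.Adj x q := hxq
    have hqS : q ∈ clN G I := by
      by_contra h
      exact hqo (mem_outN.2 ⟨hxq, h⟩)
    have hql : q ∈ lfN G I :=
      mem_lfN.2 ⟨hqS, fun h => hxS (mem_clN.2 (Or.inr ⟨q, h, hxq.symm⟩))⟩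
    refine ⟨q, fun h => hxS ((mem_ddN.1 h).2 x hxq.symm), mem_ddN.2 ⟨?_, fun w hw => ?_⟩⟩
    · rw [lfN_insert hp]
      exact Finset.mem_union_left _ (Finset.mem_erase.2 ⟨hqp, hql⟩)
    · rw [clN_insert hp, hx]
      by_cases hwS : w ∈ clN G I
      · exact Finset.mem_union_left _ hwS
      · have hle : (outN G I q).card ≤ 1 := by have := hbig q hql; omega
        have := Finset.card_le_one.1 hle w (mem_outN.2 ⟨hw, hwS⟩) x
          (mem_outN.2 ⟨hxq.symm, hxS⟩)
        simp [this]

open Classical in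
theorem exists_good_set {V : Type} [Fintype V] {G : SimpleGraph V} (hG : G.Connected)
    (hdeg : ∀ v : V, (G.neighborSet v).ncard = 1 ∨ 3 ≤ (G.neighborSet v).ncard) :
    ∃ I : Finset V, cnN G I ∧ clN G I = Finset.univ ∧
      Fintype.card V ≤ 6 * (lfN G I).card := by
  let P : Finset (Finset V) := Finset.univ.filter (fun I => cnN G I ∧
    (clN G I).card ≤ 3 * ((lfN G I).card + (ddN G I).card))
  have hP : P.Nonempty := by
    obtain ⟨r⟩ := hG.nonempty
    refine ⟨{r}, Finset.mem_filter.2 ⟨Finset.mem_univ _, ⟨r, by simp, ?_⟩, ?_⟩⟩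
    · intro a ha
      rw [Finset.mem_singleton.1 ha]
    · have h1 : clN G {r} ⊆ insert r (lfN G {r}) := by
        intro v hv
        rw [Finset.mem_insert, mem_lfN]
        by_cases e : v = r
        · exact Or.inl e
        · exact Or.inr ⟨hv, by simpa using e⟩
      have h2 := (Finset.card_le_card h1).trans (Finset.card_insert_le _ _)
      have h3 : 0 < (lfN G {r}).card := by
        have : (G.neighborSet r).ncard ≠ 0 := by have := hdeg r; omega
        obtain ⟨y, hy⟩ := Set.nonempty_of_ncard_ne_zero this
        have hy : G.Adj r y := hy
        refine Finset.card_pos.2 ⟨y, mem_lfN.2 ⟨mem_clN.2 (Or.inr ⟨r, by simp, hy⟩), ?_⟩⟩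
        simpa using hy.ne'
      omega
  obtain ⟨I, hI, hmax⟩ := P.exists_max_image Finset.card hP
  obtain ⟨-, hI1, hI2⟩ := Finset.mem_filter.1 hI
  have hU : clN G I = Finset.univ := by
    by_contra hne
    obtain ⟨J, h1, h2, h3⟩ := grow_step hG hdeg hI1 hI2 hne
    have := hmax J (Finset.mem_filter.2 ⟨Finset.mem_univ _, h1, h2⟩)
    omega
  refine ⟨I, hI1, hU, ?_⟩
  have : (ddN G I).card ≤ (lfN G I).card :=
    Finset.card_le_card fun v hv => (mem_ddN.1 hv).1
  rw [hU, Finset.card_univ] at hI2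
  omega

/-- There is a constant `c > 0` such that every finite connected
simple graph `G` with `d ≥ 2` vertices in which every vertex has degree 1 or degree at
least 3 has a spanning tree with at least `c·d` leaves. (A spanning tree is a subgraph
on the same vertex set that is connected and acyclic; a leaf is a vertex of degree 1 in
the tree.) -/
theorem exists_spanning_tree_many_leaves :
    ∃ c : ℝ, 0 < c ∧
      ∀ (V : Type) [Fintype V] (G : SimpleGraph V),
        2 ≤ Fintype.card V → G.Connected →
        (∀ v : V, (G.neighborSet v).ncard = 1 ∨ 3 ≤ (G.neighborSet v).ncard) →
        ∃ H : SimpleGraph V, H ≤ G ∧ H.Connected ∧ H.IsAcyclic ∧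
          c * (Fintype.card V : ℝ) ≤
            (Nat.card {v : V | (H.neighborSet v).ncard = 1} : ℝ) := by
  refine ⟨1 / 6, by norm_num, ?_⟩
  intro V _ G hV hG hdeg
  obtain ⟨I, ⟨r, hr, hreach⟩, hU, hcard⟩ := exists_good_set hG hdeg
  have hf : ∀ v : V, ∃ u, v ∉ I → u ∈ I ∧ G.Adj u v := by
    intro v
    by_cases hv : v ∈ I
    · exact ⟨v, fun h => absurd hv h⟩
    · have : v ∈ clN G I := by rw [hU]; exact Finset.mem_univ v
      rcases mem_clN.1 this with h | ⟨u, h1, h2⟩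
      · exact absurd h hv
      · exact ⟨u, fun _ => ⟨h1, h2⟩⟩
  choose f hf using hf
  let K : SimpleGraph V :=
    { Adj := fun a b => G.Adj a b ∧ ((a ∈ I ∧ b ∈ I) ∨ (a ∉ I ∧ b = f a) ∨ (b ∉ I ∧ a = f b))
      symm := ⟨fun a b h => ⟨h.1.symm, by tauto⟩⟩
      loopless := ⟨fun a h => G.loopless.irrefl a h.1⟩ }
  have hKG : K ≤ G := fun a b h => h.1
  have hIK : inG G I ≤ K := fun a b h => ⟨h.1, Or.inl h.2⟩
  have hKr : ∀ a, K.Reachable a r := by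
    intro a
    by_cases ha : a ∈ I
    · exact (hreach a ha).mono hIK
    · obtain ⟨h1, h2⟩ := hf a ha
      have : K.Adj a (f a) := ⟨h2.symm, Or.inr (Or.inl ⟨ha, rfl⟩)⟩
      exact this.reachable.trans ((hreach _ h1).mono hIK)
  have hK : K.Connected :=
    { preconnected := fun a b => (hKr a).trans (hKr b).symm
      nonempty := ⟨r⟩ }
  obtain ⟨T, hTK, hT⟩ := hK.exists_isTree_le
  have hTc : T.Connected := hT.connected
  refine ⟨T, hTK.trans hKG, hTc, hT.isAcyclic, ?_⟩
  have hsub : ((lfN G I : Finset V) : Set V) ⊆ {v : V | (T.neighborSet v).ncard = 1} := by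
    intro v hv
    have hvI := (mem_lfN.1 (Finset.mem_coe.1 hv)).2
    have : Nontrivial V := Fintype.one_lt_card_iff_nontrivial.1 (by omega)
    obtain ⟨w, hw⟩ := hTc.preconnected.exists_adj_of_nontrivial v
    have huniq : ∀ y, T.Adj v y → y = f v := by
      intro y hy
      obtain ⟨-, h | h | h⟩ := hTK hy
      · exact absurd h.1 hvI
      · exact h.2
      · have := (hf y h.1).1
        rw [← h.2] at this
        exact absurd this hvI
    refine Set.ncard_eq_one.2 ⟨f v, ?_⟩
    ext y
    refine ⟨fun h => huniq y h, fun h => ?_⟩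
    have h : y = f v := h
    rw [h, ← huniq w hw]
    exact hw
  have h1 := Set.ncard_le_ncard hsub (Set.toFinite _)
  rw [Set.ncard_coe_finset] at h1
  have h2 : Fintype.card V ≤ 6 * Nat.card {v : V | (T.neighborSet v).ncard = 1} := by
    rw [Nat.card_coe_set_eq]; omega
  have h3 : (Fintype.card V : ℝ) ≤
      6 * (Nat.card {v : V | (T.neighborSet v).ncard = 1} : ℝ) := by exact_mod_cast h2
  linarith
end
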